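/- There is an absolute constant c > 0 such that the following holds. Let R ⊂ ℤ be a finite set and M(R) = max_{r∈R} |r|. Let f(θ) = Σ_{n=0}^N A_n cos(nθ) be a cosine polynomial with all coefficients A_n ∈ R, and suppose |f(0)| > e^{e^{e}} (so that the iterated logarithms below are defined and positive). Then the number of distinct zeros of f in [0, 2π] is at least (c/(1 + log M(R))) · (log log log |f(0)|)/(log log log log |f(0)|) − 1. -/

import Mathlib

open Complex in
/-- The character `θ ↦ e^{inθ}`. -/
noncomputable def character (n : ℤ) (θ : ℝ) : ℂ := Complex.exp (n * θ * I)

/-- The average over a period `[0, 2π]`. -/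
noncomputable def mean {E : Type*} [NormedAddCommGroup E] [NormedSpace ℝ E] (φ : ℝ → E) : E :=
  (2 * Real.pi)⁻¹ • ∫ θ in (0 : ℝ)..2 * Real.pi, φ θ

@[fun_prop]
lemma continuous_character (n : ℤ) : Continuous (character n) := by
  unfold character; fun_prop

lemma character_eq_zpow (n : ℤ) (θ : ℝ) : character n θ = character 1 θ ^ n := by
  simp only [character, ← Complex.exp_int_mul]; push_cast; ring_nf

lemma norm_character (n : ℤ) (θ : ℝ) : ‖character n θ‖ = 1 := by
  have := Complex.norm_exp_ofReal_mul_I (n * θ); push_cast at this; exact this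

lemma character_add (m n : ℤ) (θ : ℝ) : character (m + n) θ = character m θ * character n θ := by
  simp only [character, ← Complex.exp_add]; push_cast; ring_nf

lemma character_zero (θ : ℝ) : character 0 θ = 1 := by simp [character]

lemma character_neg (n : ℤ) (θ : ℝ) :
    character (-n) θ = (starRingEnd ℂ) (character n θ) := by
  simp [character, ← Complex.exp_conj]

section mean

variable {E : Type*} [NormedAddCommGroup E] [NormedSpace ℝ E]

lemma mean_add {φ ψ : ℝ → E} (hφ : Continuous φ) (hψ : Continuous ψ) :
    mean (fun θ => φ θ + ψ θ) = mean φ + mean ψ := by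
  simp only [mean]
  rw [intervalIntegral.integral_add (hφ.intervalIntegrable _ _) (hψ.intervalIntegrable _ _),
    smul_add]

lemma mean_sub {φ ψ : ℝ → E} (hφ : Continuous φ) (hψ : Continuous ψ) :
    mean (fun θ => φ θ - ψ θ) = mean φ - mean ψ := by
  simp only [mean]
  rw [intervalIntegral.integral_sub (hφ.intervalIntegrable _ _) (hψ.intervalIntegrable _ _),
    smul_sub]

lemma mean_sum {ι : Type*} (s : Finset ι) {φ : ι → ℝ → E} (hφ : ∀ i ∈ s, Continuous (φ i)) :
    mean (fun θ => ∑ i ∈ s, φ i θ) = ∑ i ∈ s, mean (φ i) := by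
  simp only [mean]
  rw [intervalIntegral.integral_finsetSum fun i hi => (hφ i hi).intervalIntegrable _ _,
    Finset.smul_sum]

lemma mean_const_mul {𝕜 : Type*} [RCLike 𝕜] (a : 𝕜) (φ : ℝ → 𝕜) :
    mean (fun θ => a * φ θ) = a * mean φ := by
  simp only [mean]
  rw [intervalIntegral.integral_const_mul, mul_smul_comm]

lemma norm_mean_le (φ : ℝ → E) : ‖mean φ‖ ≤ mean (fun θ => ‖φ θ‖) := by
  have h : (0 : ℝ) ≤ 2 * Real.pi := by positivity
  simp only [mean, norm_smul, smul_eq_mul, norm_inv, Real.norm_of_nonneg h]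
  gcongr
  exact intervalIntegral.norm_integral_le_integral_norm h

lemma mean_mono {φ ψ : ℝ → ℝ} (hφ : Continuous φ) (hψ : Continuous ψ) (h : ∀ θ, φ θ ≤ ψ θ) :
    mean φ ≤ mean ψ := by
  have h0 : (0 : ℝ) ≤ 2 * Real.pi := by positivity
  simp only [mean, smul_eq_mul]
  gcongr
  exact intervalIntegral.integral_mono h0 (hφ.intervalIntegrable _ _) (hψ.intervalIntegrable _ _) h

lemma mean_nonneg {φ : ℝ → ℝ} (h : ∀ θ, 0 ≤ φ θ) : 0 ≤ mean φ := by
  have h0 : (0 : ℝ) ≤ 2 * Real.pi := by positivity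
  simp only [mean, smul_eq_mul]
  exact mul_nonneg (by positivity) (intervalIntegral.integral_nonneg h0 fun θ _ => h θ)

lemma re_mean {φ : ℝ → ℂ} (hφ : Continuous φ) : (mean φ).re = mean (fun θ => (φ θ).re) := by
  simp only [mean, Complex.smul_re]
  congr 1
  exact (Complex.reCLM.intervalIntegral_comp_comm (hφ.intervalIntegrable _ _)).symm

/-- Mean value property of entire functions. -/
lemma mean_comp_character {h : ℂ → ℂ} (hh : Differentiable ℂ h) :
    mean (fun θ => h (character 1 θ)) = h 0 := by
  have := hh.diffContOnCl (s := Metric.ball 0 |1|) |>.circleAverage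
  rw [← this, Real.circleAverage_def, mean]
  simp [circleMap, character]

lemma mean_character (n : ℤ) : mean (character n) = if n = 0 then 1 else 0 := by
  have nonneg_case : ∀ n : ℕ, mean (character n) = if n = 0 then 1 else 0 := fun n => by
    have := mean_comp_character (h := fun z => z ^ n) (by fun_prop)
    rw [zero_pow_eq] at this
    rw [← this]
    congr 1; ext θ
    rw [character_eq_zpow, zpow_natCast]
  obtain ⟨k, rfl | rfl⟩ := n.eq_nat_or_neg
  · simpa using nonneg_case k
  · have h2 : mean (character (-k)) = (starRingEnd ℂ) (mean (character k)) := by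
      simp only [mean, funext (character_neg k)]
      rw [Complex.real_smul, Complex.real_smul, map_mul, Complex.conj_ofReal,
        ← intervalIntegral.intervalIntegral_conj]
    rw [h2, nonneg_case k]
    split_ifs <;> simp_all

end mean

open Finset in
lemma normSq_sum_eq {ι : Type*} [LinearOrder ι] (s : Finset ι) (a : ι → ℂ) :
    ‖∑ n ∈ s, a n‖ ^ 2 = (∑ n ∈ s, (‖a n‖ ^ 2 : ℂ) +
      2 * ∑ n ∈ s, ∑ m ∈ s with m < n, a n * (starRingEnd ℂ) (a m)).re := by
  have key : ∀ n m : ι, (a n * (starRingEnd ℂ) (a m)).re =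
      (if m < n then (a n * (starRingEnd ℂ) (a m)).re else 0) +
      (if n = m then (a n * (starRingEnd ℂ) (a m)).re else 0) +
      (if n < m then (a n * (starRingEnd ℂ) (a m)).re else 0) := fun n m => by
    rcases lt_trichotomy n m with h | h | h
    · simp [h, h.ne, h.not_gt]
    · simp [h]
    · simp [h, h.ne', h.not_gt]
  have swap : ∑ n ∈ s, ∑ m ∈ s, (if n < m then (a n * (starRingEnd ℂ) (a m)).re else 0) =
      ∑ n ∈ s, ∑ m ∈ s, (if m < n then (a n * (starRingEnd ℂ) (a m)).re else 0) := by
    rw [sum_comm]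
    refine sum_congr rfl fun n _ => sum_congr rfl fun m _ => ?_
    congr 1
    simp [Complex.mul_re]; ring
  have h1 : ‖∑ n ∈ s, a n‖ ^ 2 = ∑ n ∈ s, ∑ m ∈ s, (a n * (starRingEnd ℂ) (a m)).re := by
    have h2 := Complex.mul_conj (∑ n ∈ s, a n)
    rw [Complex.normSq_eq_norm_sq, map_sum, sum_mul_sum] at h2
    have h3 := congrArg Complex.re h2
    rw [Complex.ofReal_re] at h3
    rw [← h3]; simp [Complex.re_sum]
  rw [h1]
  rw [sum_congr rfl fun n _ => sum_congr rfl fun m _ => key n m]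
  simp only [sum_add_distrib]
  rw [swap]
  have diag : ∑ n ∈ s, ∑ m ∈ s, (if n = m then (a n * (starRingEnd ℂ) (a m)).re else 0) =
      ∑ n ∈ s, ‖a n‖ ^ 2 := by
    refine sum_congr rfl fun n hn => ?_
    rw [sum_ite_eq, if_pos hn, Complex.mul_conj, Complex.ofReal_re, Complex.normSq_eq_norm_sq]
  rw [diag]
  have two : ∀ z : ℂ, (2 * z).re = 2 * z.re := fun z => by simp
  have sq : ∑ n ∈ s, (‖a n‖ ^ 2 : ℂ) = ((∑ n ∈ s, ‖a n‖ ^ 2 : ℝ) : ℂ) := by push_cast; rfl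
  rw [Complex.add_re, two, sq, Complex.ofReal_re, Complex.re_sum]
  simp_rw [Complex.re_sum, sum_filter]
  ring

/-- The analytic function whose real part on the circle is the squared modulus of a
trigonometric polynomial. -/
lemma exists_entire_re_eq_normSq (E : Finset ℤ) (u : ℤ → ℂ) (hu : ∀ n, ‖u n‖ ≤ 1) {N : ℝ}
    (hN : 0 < N) (hE : (E.card : ℝ) ≤ N) :
    ∃ (h : ℂ → ℂ) (p : ℝ), Differentiable ℂ h ∧
      (∀ θ, (h (character 1 θ)).re = ‖(N : ℂ)⁻¹ * ∑ n ∈ E, u n * character n θ‖ ^ 2) ∧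
      h 0 = p ∧ 0 ≤ p ∧ p ≤ N⁻¹ := by
  refine ⟨fun z => ((N⁻¹ ^ 2 : ℝ) : ℂ) * (∑ n ∈ E, (‖u n‖ ^ 2 : ℂ) +
      2 * ∑ n ∈ E, ∑ m ∈ E with m < n, u n * (starRingEnd ℂ) (u m) * z ^ (n - m).toNat),
    N⁻¹ ^ 2 * ∑ n ∈ E, ‖u n‖ ^ 2, by fun_prop, fun θ => ?_, ?_, by positivity, ?_⟩
  · have diag : ∑ n ∈ E, (‖u n * character n θ‖ ^ 2 : ℂ) = ∑ n ∈ E, (‖u n‖ ^ 2 : ℂ) :=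
      Finset.sum_congr rfl fun n _ => by rw [norm_mul, norm_character, mul_one]
    have off : ∑ n ∈ E, ∑ m ∈ E with m < n, u n * character n θ *
        (starRingEnd ℂ) (u m * character m θ) =
        ∑ n ∈ E, ∑ m ∈ E with m < n,
          u n * (starRingEnd ℂ) (u m) * character 1 θ ^ (n - m).toNat := by
      refine Finset.sum_congr rfl fun n _ => Finset.sum_congr rfl fun m hm => ?_
      have hmn : m ≤ n := (Finset.mem_filter.1 hm).2.le
      rw [map_mul, ← character_neg, mul_mul_mul_comm, ← character_add, ← zpow_natCast,
        Int.toNat_of_nonneg (by lia), ← character_eq_zpow, sub_eq_add_neg]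
    rw [norm_mul, mul_pow, normSq_sum_eq, Complex.re_ofReal_mul, diag, off]
    simp
  · have : ∀ n ∈ E, ∑ m ∈ E with m < n,
        u n * (starRingEnd ℂ) (u m) * (0 : ℂ) ^ (n - m).toNat = 0 := fun n _ =>
      Finset.sum_eq_zero fun m hm => by
        have hmn : m < n := (Finset.mem_filter.1 hm).2
        rw [zero_pow (by lia), mul_zero]
    simp only [Finset.sum_eq_zero this]; push_cast; ring
  · have : ∑ n ∈ E, ‖u n‖ ^ 2 ≤ N := le_trans (Finset.sum_le_card_nsmul _ _ 1 fun n _ =>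
      pow_le_one₀ (norm_nonneg _) (hu n)) (by simpa using hE)
    calc N⁻¹ ^ 2 * ∑ n ∈ E, ‖u n‖ ^ 2 ≤ N⁻¹ ^ 2 * N := by gcongr
      _ = N⁻¹ := by field_simp

lemma norm_block_le_one (E : Finset ℤ) (u : ℤ → ℂ) (hu : ∀ n, ‖u n‖ ≤ 1) {N : ℝ}
    (hN : 0 < N) (hE : (E.card : ℝ) ≤ N) (θ : ℝ) :
    ‖(N : ℂ)⁻¹ * ∑ n ∈ E, u n * character n θ‖ ≤ 1 := by
  have : ‖∑ n ∈ E, u n * character n θ‖ ≤ N := by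
    refine le_trans ((norm_sum_le _ _).trans (Finset.sum_le_card_nsmul _ _ 1 fun n _ => ?_))
      (by simpa using hE)
    rw [norm_mul, norm_character, mul_one]; exact hu n
  rw [norm_mul, norm_inv, Complex.norm_real, Real.norm_of_nonneg hN.le, inv_mul_le_iff₀ hN, mul_one]
  exact this

lemma mean_normSq_entire_le {h : ℂ → ℂ} {f : ℝ → ℂ} {p q : ℝ} (hh : Differentiable ℂ h)
    (hf : Continuous f) (hre : ∀ θ, (h (character 1 θ)).re = ‖f θ‖ ^ 2) (hf1 : ∀ θ, ‖f θ‖ ≤ 1)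
    (h0 : h 0 = p) (hpq : p ≤ q) :
    mean (fun θ => ‖f θ‖ ^ 2) ≤ q ∧ mean (fun θ => ‖h (character 1 θ)‖ ^ 2) ≤ 2 * q := by
  have hc : Continuous fun θ => h (character 1 θ) := hh.continuous.comp (by fun_prop)
  have h1 : mean (fun θ => ‖f θ‖ ^ 2) = p := by
    rw [← funext hre, ← re_mean hc, mean_comp_character hh, h0, Complex.ofReal_re]
  have h2 : mean (fun θ => (h (character 1 θ) ^ 2).re) = p ^ 2 := by
    rw [← re_mean (φ := fun θ => h (character 1 θ) ^ 2) (hc.pow 2),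
      mean_comp_character (h := fun z => h z ^ 2) (by fun_prop), h0,
      ← Complex.ofReal_pow, Complex.ofReal_re]
  have hle : mean (fun θ => ‖h (character 1 θ)‖ ^ 2) ≤
      mean (fun θ => 2 * ‖f θ‖ ^ 2 - (h (character 1 θ) ^ 2).re) := by
    refine mean_mono (hc.norm.pow 2) ((by fun_prop : Continuous fun θ => 2 * ‖f θ‖ ^ 2).sub
      (Complex.continuous_re.comp (hc.pow 2))) fun θ => ?_
    have := hre θ
    have h4 : (‖f θ‖ ^ 2) ^ 2 ≤ ‖f θ‖ ^ 2 :=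
      pow_le_of_le_one (by positivity) (pow_le_one₀ (norm_nonneg _) (hf1 θ)) two_ne_zero
    rw [← this] at h4 ⊢
    rw [← Complex.normSq_eq_norm_sq, Complex.normSq_apply, pow_two, Complex.mul_re]
    nlinarith
  rw [mean_sub (φ := fun θ => 2 * ‖f θ‖ ^ 2) (ψ := fun θ => (h (character 1 θ) ^ 2).re)
    (by fun_prop) (Complex.continuous_re.comp (hc.pow 2)), mean_const_mul, h1, h2]
    at hle
  exact ⟨h1 ▸ hpq, by nlinarith [sq_nonneg p]⟩

lemma norm_exp_neg_sub_one_le {z : ℂ} (hz : 0 ≤ z.re) : ‖Complex.exp (-z) - 1‖ ≤ ‖z‖ := by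
  have h := (convex_halfSpace_re_ge 0).norm_image_sub_le_of_norm_hasDerivWithin_le
    (f := fun w => Complex.exp (-w)) (f' := fun w => -Complex.exp (-w)) (C := 1)
    (x := 0) (y := z) (fun w _ => by
      simpa using ((hasDerivAt_id w).neg.cexp).hasDerivWithinAt)
    (fun w hw => by simpa [Complex.norm_exp] using hw) (by simp) hz
  simpa using h

/-- One step of the corrector construction keeps the sup norm under control. -/
lemma norm_corrected_sum_le (f h : ℕ → ℂ) (hre : ∀ i, (h i).re = ‖f i‖ ^ 2)
    (hf : ∀ i, ‖f i‖ ≤ 1) {s : ℝ} (hs : 0 ≤ s) (k : ℕ) :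
    ‖∑ i ∈ Finset.range k, s * (f i * Complex.exp (-∑ l ∈ Finset.Ico (i + 1) k, h l))‖ ≤
      1 + k * (s ^ 2 / 2) := by
  induction k with
  | zero => simp
  | succ k ih =>
    have step : ∑ i ∈ Finset.range (k + 1),
        s * (f i * Complex.exp (-∑ l ∈ Finset.Ico (i + 1) (k + 1), h l)) =
        (∑ i ∈ Finset.range k, s * (f i * Complex.exp (-∑ l ∈ Finset.Ico (i + 1) k, h l))) *
          Complex.exp (-h k) + s * f k := by
      rw [Finset.sum_range_succ, Finset.sum_mul]
      congr 1
      · refine Finset.sum_congr rfl fun i hi => ?_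
        have := Finset.mem_range.1 hi
        rw [Finset.sum_Ico_succ_top (by lia), neg_add, Complex.exp_add]
        ring
      · simp
    rw [step]
    refine (norm_add_le _ _).trans ?_
    rw [norm_mul, norm_mul, Complex.norm_exp, Complex.neg_re, hre, Complex.norm_real,
      Real.norm_of_nonneg hs]
    set x := ‖f k‖
    have hx0 : 0 ≤ x := norm_nonneg _
    have hx1 : x ≤ 1 := hf k
    have hexp : Real.exp (-x ^ 2) ≤ 1 - x ^ 2 / 2 := by
      rw [Real.exp_neg, inv_le_comm₀ (Real.exp_pos _) (by nlinarith)]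
      refine le_trans ?_ (Real.add_one_le_exp (x ^ 2))
      rw [inv_le_iff_one_le_mul₀ (by nlinarith)]
      nlinarith [mul_nonneg (sq_nonneg x) (sub_nonneg.2 (pow_le_one₀ hx0 hx1 : x ^ 2 ≤ 1))]
    have hks : 0 ≤ k * (s ^ 2 / 2) := by positivity
    calc _ ≤ (1 + k * (s ^ 2 / 2)) * (1 - x ^ 2 / 2) + s * x := by gcongr
      _ ≤ _ := by push_cast; nlinarith [sq_nonneg (s - x), mul_nonneg hks (sq_nonneg x)]

lemma mean_block_mul_exp_eq_zero {H : ℂ → ℂ} (hH : Differentiable ℂ H) (E : Finset ℤ)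
    (u : ℤ → ℂ) (N : ℂ) {n : ℤ} (hn : ∀ j ∈ E, n < j) :
    mean (fun θ => N * (∑ j ∈ E, u j * character j θ) * Complex.exp (-H (character 1 θ)) *
      character (-n) θ) = 0 := by
  have hc : Continuous fun θ => H (character 1 θ) := hH.continuous.comp (by fun_prop)
  have : ∀ θ, N * (∑ j ∈ E, u j * character j θ) * Complex.exp (-H (character 1 θ)) *
      character (-n) θ = ∑ j ∈ E, N * u j *
        (character 1 θ ^ (j - n).toNat * Complex.exp (-H (character 1 θ))) := fun θ => by
    rw [Finset.mul_sum, Finset.sum_mul, Finset.sum_mul]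
    refine Finset.sum_congr rfl fun j hj => ?_
    have hj := hn j hj
    rw [← zpow_natCast, Int.toNat_of_nonneg (by lia), ← character_eq_zpow, sub_eq_add_neg,
      character_add]
    ring
  have hcont : ∀ j, Continuous fun θ => N * u j *
      (character 1 θ ^ (j - n).toNat * Complex.exp (-H (character 1 θ))) := fun j =>
    continuous_const.mul (((continuous_character 1).pow _).mul hc.neg.cexp)
  rw [funext this, mean_sum _ fun j _ => hcont j]
  refine Finset.sum_eq_zero fun j hj => ?_
  have hj := hn j hj
  rw [mean_const_mul, mean_comp_character
    (h := fun z => z ^ (j - n).toNat * Complex.exp (-H z)) (by fun_prop)]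
  rw [zero_pow (by lia)]; simp

lemma mean_block (E : Finset ℤ) (u : ℤ → ℂ) (N : ℂ) (n : ℤ) :
    mean (fun θ => N * (∑ j ∈ E, u j * character j θ) * character (-n) θ) =
      if n ∈ E then N * u n else 0 := by
  have : ∀ θ, N * (∑ j ∈ E, u j * character j θ) * character (-n) θ =
      ∑ j ∈ E, N * u j * character (j - n) θ := fun θ => by
    rw [Finset.mul_sum, Finset.sum_mul]
    refine Finset.sum_congr rfl fun j hj => ?_
    rw [sub_eq_add_neg, character_add]
    ring
  rw [funext this, mean_sum _ fun j _ => by fun_prop]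
  simp_rw [mean_const_mul, mean_character, sub_eq_zero, mul_ite, mul_one, mul_zero]
  rw [Finset.sum_ite_eq']

lemma norm_mean_mul_exp_sub_le {f H : ℝ → ℂ} (hf : Continuous f) (hH : Continuous H)
    (hre : ∀ θ, 0 ≤ (H θ).re) (n : ℤ) :
    ‖mean (fun θ => f θ * Complex.exp (-H θ) * character n θ) -
      mean (fun θ => f θ * character n θ)‖ ≤ mean (fun θ => ‖f θ‖ * ‖H θ‖) := by
  rw [← mean_sub (by fun_prop) (by fun_prop)]
  refine (norm_mean_le _).trans (mean_mono (by fun_prop) (by fun_prop) fun θ => ?_)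
  have : f θ * Complex.exp (-H θ) * character n θ - f θ * character n θ =
      f θ * (Complex.exp (-H θ) - 1) * character n θ := by ring
  rw [this, norm_mul, norm_mul, norm_character, mul_one]
  gcongr
  exact norm_exp_neg_sub_one_le (hre θ)

lemma mean_norm_mul_le {f h : ℝ → ℂ} (hf : Continuous f) (hh : Continuous h) {a b α : ℝ}
    (hα : 0 < α) (ha : mean (fun θ => ‖f θ‖ ^ 2) ≤ a) (hb : mean (fun θ => ‖h θ‖ ^ 2) ≤ b) :
    mean (fun θ => ‖f θ‖ * ‖h θ‖) ≤ (α * a + α⁻¹ * b) / 2 := by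
  have : mean (fun θ => ‖f θ‖ * ‖h θ‖) ≤
      mean (fun θ => α / 2 * ‖f θ‖ ^ 2 + α⁻¹ / 2 * ‖h θ‖ ^ 2) := by
    refine mean_mono (by fun_prop) (by fun_prop) fun θ => ?_
    have h1 : α⁻¹ * α = 1 := inv_mul_cancel₀ hα.ne'
    have h2 : α / 2 * ‖f θ‖ ^ 2 + α⁻¹ / 2 * ‖h θ‖ ^ 2 - ‖f θ‖ * ‖h θ‖ =
      α⁻¹ / 2 * (α * ‖f θ‖ - ‖h θ‖) ^ 2 := by
      field_simp; ring
    have h3 : 0 ≤ α⁻¹ / 2 * (α * ‖f θ‖ - ‖h θ‖) ^ 2 := by positivity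
    linarith
  rw [mean_add (by fun_prop) (by fun_prop), mean_const_mul, mean_const_mul] at this
  have h1 : α / 2 * mean (fun θ => ‖f θ‖ ^ 2) ≤ α / 2 * a := by gcongr
  have h2 : α⁻¹ / 2 * mean (fun θ => ‖h θ‖ ^ 2) ≤ α⁻¹ / 2 * b := by gcongr
  linarith

lemma sum_tail_error_le (N₀ : ℝ) (hN₀ : 0 < N₀) (m K : ℕ) :
    ∑ i ∈ Finset.Ico m K, ∑ l ∈ Finset.Ico (i + 1) K, 3 / 2 * ((8 : ℝ)⁻¹ ^ (i + l) / N₀) ≤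
      (N₀ * 64 ^ m)⁻¹ / 2 := by
  have inner : ∀ i, ∑ l ∈ Finset.Ico (i + 1) K, 3 / 2 * ((8 : ℝ)⁻¹ ^ (i + l) / N₀) ≤
      3 / 14 / N₀ * (64 : ℝ)⁻¹ ^ i := fun i => by
    have h := geom_sum_Ico_le_of_lt_one (m := i + 1) (n := K) (x := (8 : ℝ)⁻¹)
      (by norm_num) (by norm_num)
    have h64 : (64 : ℝ)⁻¹ ^ i = (8 : ℝ)⁻¹ ^ i * (8 : ℝ)⁻¹ ^ i := by
      rw [← mul_pow]; norm_num
    have : ∑ l ∈ Finset.Ico (i + 1) K, 3 / 2 * ((8 : ℝ)⁻¹ ^ (i + l) / N₀) =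
        3 / 2 / N₀ * (8 : ℝ)⁻¹ ^ i * ∑ l ∈ Finset.Ico (i + 1) K, (8 : ℝ)⁻¹ ^ l := by
      rw [Finset.mul_sum]
      refine Finset.sum_congr rfl fun l _ => ?_
      rw [pow_add]; ring
    rw [this]
    calc _ ≤ 3 / 2 / N₀ * (8 : ℝ)⁻¹ ^ i * ((8 : ℝ)⁻¹ ^ (i + 1) / (1 - 8⁻¹)) := by gcongr
      _ = _ := by rw [h64, pow_succ]; ring
  calc _ ≤ ∑ i ∈ Finset.Ico m K, 3 / 14 / N₀ * (64 : ℝ)⁻¹ ^ i :=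
        Finset.sum_le_sum fun i _ => inner i
    _ = 3 / 14 / N₀ * ∑ i ∈ Finset.Ico m K, (64 : ℝ)⁻¹ ^ i := by rw [Finset.mul_sum]
    _ ≤ 3 / 14 / N₀ * ((64 : ℝ)⁻¹ ^ m / (1 - 64⁻¹)) := by
        gcongr
        exact geom_sum_Ico_le_of_lt_one (by norm_num) (by norm_num)
    _ = (3 / 14 / (1 - 64⁻¹)) * ((64 : ℝ)⁻¹ ^ m / N₀) := by ring
    _ ≤ 1 / 2 * ((64 : ℝ)⁻¹ ^ m / N₀) :=
        mul_le_mul_of_nonneg_right (by norm_num) (by positivity)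
    _ = _ := by rw [mul_inv, inv_pow]; ring

/-- A Littlewood-type lower bound for `L¹` norms: geometrically growing blocks of coefficients,
ordered from the top downwards, each contribute `K^{-1/2}` times the average modulus. -/
lemma sum_block_le (K : ℕ) (E : ℕ → Finset ℤ) {N₀ : ℝ} (hN₀ : 0 < N₀)
    (hcard : ∀ i, ((E i).card : ℝ) ≤ N₀ * 64 ^ i)
    (hord : ∀ i j, i < j → ∀ x ∈ E i, ∀ y ∈ E j, y < x)
    (T : Finset ℤ) (c : ℤ → ℂ)
    (hT : ∀ n ∈ T, (∃ i < K, n ∈ E i) ∨ ∀ i < K, ∀ y ∈ E i, n < y) (hsub : ∀ i, E i ⊆ T) :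
    ∑ i ∈ Finset.range K, (N₀ * 64 ^ i)⁻¹ * ∑ n ∈ E i, ‖c n‖ ≤
      3 * √K * mean (fun θ => ‖∑ n ∈ T, c n * character (-n) θ‖) := by
  classical
  rcases K.eq_zero_or_pos with rfl | hK
  · simp
  set u : ℤ → ℂ := fun n => (starRingEnd ℂ) (c n) / ‖c n‖ with hu_def
  have hu : ∀ n, ‖u n‖ ≤ 1 := fun n => by
    rw [hu_def]; simp only [norm_div, RCLike.norm_conj, Complex.norm_real, norm_norm]
    exact div_self_le_one _
  have hcu : ∀ n, c n * u n = ‖c n‖ := fun n => by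
    rcases eq_or_ne (c n) 0 with h | h
    · simp [h]
    · have : (‖c n‖ : ℂ) ≠ 0 := by simpa using h
      rw [hu_def]; simp only
      rw [mul_div_assoc', Complex.mul_conj, Complex.normSq_eq_norm_sq]
      push_cast; field_simp
  set N : ℕ → ℝ := fun i => N₀ * 64 ^ i with hN_def
  have hN : ∀ i, 0 < N i := fun i => by positivity
  set f : ℕ → ℝ → ℂ := fun i θ => ((N i : ℝ) : ℂ)⁻¹ * ∑ n ∈ E i, u n * character n θ with hf_def
  have hfc : ∀ i, Continuous (f i) := fun i => by rw [hf_def]; fun_prop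
  choose h p hh hre h0 hp0 hp using fun i => exists_entire_re_eq_normSq (E i) u hu (hN i) (hcard i)
  have hf1 : ∀ i θ, ‖f i θ‖ ≤ 1 := fun i θ => norm_block_le_one (E i) u hu (hN i) (hcard i) θ
  have hmean := fun i => mean_normSq_entire_le (hh i) (hfc i) (hre i) (hf1 i) (h0 i) (hp i)
  have hhc : ∀ i, Continuous fun θ => h i (character 1 θ) :=
    fun i => (hh i).continuous.comp (by fun_prop)
  have herr : ∀ i l, mean (fun θ => ‖f i θ‖ * ‖h l (character 1 θ)‖) ≤
      3 / 2 * ((8 : ℝ)⁻¹ ^ (i + l) / N₀) := fun i l => by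
    refine (mean_norm_mul_le (hfc i) (hhc l) (α := 8 ^ i / 8 ^ l) (by positivity)
      (hmean i).1 (hmean l).2).trans (le_of_eq ?_)
    have h64 : ∀ i, (64 : ℝ) ^ i = 8 ^ i * 8 ^ i := fun i => by rw [← mul_pow]; norm_num
    rw [hN_def]; simp only [h64]
    rw [inv_pow, pow_add]
    field_simp; norm_num
  set H : ℕ → ℂ → ℂ := fun i z => ∑ l ∈ Finset.Ico (i + 1) K, h l z with hH_def
  have hH : ∀ i, Differentiable ℂ (H i) := fun i => by
    rw [hH_def]; exact Differentiable.fun_sum fun l _ => hh l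
  have hHc : ∀ i, Continuous fun θ => H i (character 1 θ) :=
    fun i => (hH i).continuous.comp (by fun_prop)
  have hHre : ∀ i θ, 0 ≤ (H i (character 1 θ)).re := fun i θ => by
    rw [hH_def]; simp only [Complex.re_sum]
    exact Finset.sum_nonneg fun l _ => by rw [hre]; positivity
  have hHerr : ∀ i, mean (fun θ => ‖f i θ‖ * ‖H i (character 1 θ)‖) ≤
      ∑ l ∈ Finset.Ico (i + 1) K, 3 / 2 * ((8 : ℝ)⁻¹ ^ (i + l) / N₀) := fun i => by
    refine le_trans (mean_mono ((hfc i).norm.mul (hHc i).norm)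
      (continuous_finsetSum _ fun l _ => (hfc i).norm.mul (hhc l).norm) fun θ => ?_)
      ((mean_sum (Finset.Ico (i + 1) K) (φ := fun l θ => ‖f i θ‖ * ‖h l (character 1 θ)‖)
        fun l _ => (hfc i).norm.mul (hhc l).norm).trans_le (Finset.sum_le_sum fun l _ => herr i l))
    change _ ≤ ∑ l ∈ Finset.Ico (i + 1) K, ‖f i θ‖ * ‖h l (character 1 θ)‖
    rw [← Finset.mul_sum]
    gcongr
    exact norm_sum_le _ _
  set g : ℕ → ℤ → ℂ := fun i n =>
    mean (fun θ => f i θ * Complex.exp (-H i (character 1 θ)) * character (-n) θ) with hg_def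
  have hg0 : ∀ i n, (∀ j ∈ E i, n < j) → g i n = 0 := fun i n hn =>
    mean_block_mul_exp_eq_zero (hH i) (E i) u _ hn
  have hg : ∀ i n, ‖g i n - (if n ∈ E i then ((N i : ℝ) : ℂ)⁻¹ * u n else 0)‖ ≤
      ∑ l ∈ Finset.Ico (i + 1) K, 3 / 2 * ((8 : ℝ)⁻¹ ^ (i + l) / N₀) := fun i n => by
    rw [← mean_block]
    exact (norm_mean_mul_exp_sub_le (hfc i) (hHc i) (hHre i) (-n)).trans (hHerr i)
  have hblock : ∀ m < K, ∀ n ∈ E m, (N m)⁻¹ * ‖c n‖ / 2 ≤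
      (c n * ∑ i ∈ Finset.range K, g i n).re := fun m hm n hn => by
    have hsplit : ∑ i ∈ Finset.range K, g i n = ∑ i ∈ Finset.Ico m K, g i n := by
      rw [← Finset.sum_range_add_sum_Ico _ hm.le, Finset.sum_eq_zero, zero_add]
      exact fun i hi => hg0 i n fun j hj => hord i m (Finset.mem_range.1 hi) j hj n hn
    have hmain : ∑ i ∈ Finset.Ico m K, (if n ∈ E i then ((N i : ℝ) : ℂ)⁻¹ * u n else 0) =
        ((N m : ℝ) : ℂ)⁻¹ * u n := by
      rw [Finset.sum_eq_single m, if_pos hn]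
      · intro i hi him
        rw [if_neg fun hni => ?_]
        exact (hord m i (lt_of_le_of_ne (Finset.mem_Ico.1 hi).1 him.symm) n hn n hni).false
      · intro hm'; simp [hm] at hm'
    have hdiff : ‖∑ i ∈ Finset.range K, g i n - ((N m : ℝ) : ℂ)⁻¹ * u n‖ ≤ (N m)⁻¹ / 2 := by
      rw [hsplit, ← hmain, ← Finset.sum_sub_distrib]
      exact (norm_sum_le _ _).trans ((Finset.sum_le_sum fun i _ => hg i n).trans
        (sum_tail_error_le N₀ hN₀ m K))
    have heq : c n * ∑ i ∈ Finset.range K, g i n = (((N m)⁻¹ * ‖c n‖ : ℝ) : ℂ) +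
        c n * (∑ i ∈ Finset.range K, g i n - ((N m : ℝ) : ℂ)⁻¹ * u n) := by
      rw [mul_sub, mul_left_comm, hcu]; push_cast; ring
    rw [heq, Complex.add_re, Complex.ofReal_re]
    have h1 := (abs_le.1 (Complex.abs_re_le_norm
      (c n * (∑ i ∈ Finset.range K, g i n - ((N m : ℝ) : ℂ)⁻¹ * u n)))).1
    rw [norm_mul] at h1
    have h2 := mul_le_mul_of_nonneg_left hdiff (norm_nonneg (c n))
    linarith
  have hrest : ∀ n ∈ T, (∀ i < K, n ∉ E i) → ∑ i ∈ Finset.range K, g i n = 0 :=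
    fun n hn hni => Finset.sum_eq_zero fun i hi => by
      rcases hT n hn with ⟨j, hj, hnj⟩ | h'
      · exact absurd hnj (hni j hj)
      · exact hg0 i n (h' i (Finset.mem_range.1 hi))
  set s : ℝ := (√K)⁻¹ with hs_def
  have hsqrt : 0 < √(K : ℝ) := Real.sqrt_pos.2 (by exact_mod_cast hK)
  have hs : 0 ≤ s := by positivity
  set Ψ : ℝ → ℂ := fun θ => ∑ i ∈ Finset.range K,
    s * (f i θ * Complex.exp (-∑ l ∈ Finset.Ico (i + 1) K, h l (character 1 θ))) with hΨ_def
  have hΨ : ∀ θ, ‖Ψ θ‖ ≤ 3 / 2 := fun θ => by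
    refine (norm_corrected_sum_le (fun i => f i θ) (fun l => h l (character 1 θ))
      (fun i => hre i θ) (fun i => hf1 i θ) hs K).trans (le_of_eq ?_)
    rw [hs_def, inv_pow, Real.sq_sqrt (by positivity)]
    have : (K : ℝ) ≠ 0 := by positivity
    field_simp; norm_num
  have hterm : ∀ i, Continuous fun θ =>
      f i θ * Complex.exp (-H i (character 1 θ)) := fun i => (hfc i).mul (hHc i).neg.cexp
  have hΨc : Continuous Ψ := continuous_finsetSum _ fun i _ => continuous_const.mul (hterm i)
  have hΨg : ∀ n, mean (fun θ => Ψ θ * character (-n) θ) =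
      s * ∑ i ∈ Finset.range K, g i n := fun n => by
    have : ∀ θ, Ψ θ * character (-n) θ = ∑ i ∈ Finset.range K,
        s * (f i θ * Complex.exp (-H i (character 1 θ)) * character (-n) θ) := fun θ => by
      rw [hΨ_def]; simp only [Finset.sum_mul, mul_assoc]; rfl
    have hcont : ∀ i, Continuous fun θ =>
        s * (f i θ * Complex.exp (-H i (character 1 θ)) * character (-n) θ) :=
      fun i => continuous_const.mul ((hterm i).mul (continuous_character _))
    rw [funext this, mean_sum _ fun i _ => hcont i, Finset.mul_sum]
    exact Finset.sum_congr rfl fun i _ => mean_const_mul _ _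
  set G : ℝ → ℂ := fun θ => ∑ n ∈ T, c n * character (-n) θ with hG_def
  have hGc : Continuous G := by rw [hG_def]; fun_prop
  have hpair : mean (fun θ => Ψ θ * G θ) = s * ∑ n ∈ T, c n * ∑ i ∈ Finset.range K, g i n := by
    have : ∀ θ, Ψ θ * G θ = ∑ n ∈ T, c n * (Ψ θ * character (-n) θ) := fun θ => by
      rw [hG_def]; simp only [Finset.mul_sum]
      exact Finset.sum_congr rfl fun n _ => by ring
    rw [funext this, mean_sum _ fun n _ => by fun_prop, Finset.mul_sum]
    refine Finset.sum_congr rfl fun n _ => ?_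
    rw [mean_const_mul, hΨg]; ring
  have hupper : ‖mean (fun θ => Ψ θ * G θ)‖ ≤ 3 / 2 * mean (fun θ => ‖G θ‖) := by
    rw [← mean_const_mul]
    refine (norm_mean_le _).trans (mean_mono (by fun_prop) (by fun_prop) fun θ => ?_)
    rw [norm_mul]
    exact mul_le_mul_of_nonneg_right (hΨ θ) (norm_nonneg _)
  have hdisj : ∀ n, ∀ i j, n ∈ E i → n ∈ E j → i = j := fun n i j hi hj => by
    rcases lt_trichotomy i j with h | h | h
    · exact absurd (hord i j h n hi n hj) (lt_irrefl n)
    · exact h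
    · exact absurd (hord j i h n hj n hi) (lt_irrefl n)
  have hlower : (∑ i ∈ Finset.range K, (N i)⁻¹ * ∑ n ∈ E i, ‖c n‖) / 2 ≤
      (∑ n ∈ T, c n * ∑ i ∈ Finset.range K, g i n).re := by
    have hbi : (Finset.range K).biUnion E ⊆ T := Finset.biUnion_subset.2 fun i _ => hsub i
    rw [← Finset.sum_subset hbi fun n hn hni => ?_, Finset.sum_biUnion, Complex.re_sum,
      Finset.sum_div]
    · refine Finset.sum_le_sum fun i hi => ?_
      rw [Complex.re_sum, Finset.mul_sum, Finset.sum_div]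
      exact Finset.sum_le_sum fun n hn => hblock i (Finset.mem_range.1 hi) n hn
    · intro i _ j _ hij
      exact Finset.disjoint_left.2 fun n hi hj => hij (hdisj n i j hi hj)
    · rw [hrest n hn fun i hi hni' => hni (Finset.mem_biUnion.2 ⟨i, Finset.mem_range.2 hi, hni'⟩),
        mul_zero]
  have hfin := (Complex.re_le_norm _).trans hupper
  rw [hpair, Complex.re_ofReal_mul] at hfin
  have h2 := mul_le_mul_of_nonneg_left hlower hs
  have h3 := mul_le_mul_of_nonneg_left (h2.trans hfin) hsqrt.le
  rw [← mul_assoc, hs_def, mul_inv_cancel₀ hsqrt.ne', one_mul] at h3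
  linarith

/-- The number of elements of `L` above `n`. -/
def rankAbove (L : Finset ℤ) (n : ℤ) : ℕ := (L.filter (n < ·)).card

lemma rankAbove_anti (L : Finset ℤ) {m n : ℤ} (h : m ≤ n) : rankAbove L n ≤ rankAbove L m :=
  Finset.card_le_card fun l hl => by
    rw [Finset.mem_filter] at hl ⊢; exact ⟨hl.1, h.trans_lt hl.2⟩

lemma rankAbove_lt (L : Finset ℤ) {m n : ℤ} (hn : n ∈ L) (h : m < n) :
    rankAbove L n < rankAbove L m :=
  Finset.card_lt_card <| Finset.ssubset_iff_of_subset (fun l hl => by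
    rw [Finset.mem_filter] at hl ⊢; exact ⟨hl.1, h.trans hl.2⟩) |>.2
    ⟨n, by simp [hn, h], by simp⟩

lemma rankAbove_le_add (L : Finset ℤ) {m n : ℤ} (D : ℕ) (h : n ≤ m + D) :
    rankAbove L m ≤ rankAbove L n + D := by
  have : L.filter (m < ·) ⊆ L.filter (n < ·) ∪ Finset.Ioc m n := fun l hl => by
    simp only [Finset.mem_filter, Finset.mem_union, Finset.mem_Ioc] at hl ⊢
    rcases lt_or_ge n l with h' | h'
    · exact Or.inl ⟨hl.1, h'⟩
    · exact Or.inr ⟨hl.2, h'⟩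
  refine (Finset.card_le_card this).trans ((Finset.card_union_le _ _).trans ?_)
  rw [Int.card_Ioc]
  exact Nat.add_le_add_left (by lia) _

lemma card_filter_rankAbove (L : Finset ℤ) (p : ℕ → Prop) [DecidablePred p] :
    (L.filter fun n => p (rankAbove L n)).card = ((Finset.range L.card).filter p).card := by
  have inj : Set.InjOn (rankAbove L) L := fun m hm n hn h => by
    rcases lt_trichotomy m n with h' | h' | h'
    · exact absurd h (rankAbove_lt L hn h').ne'
    · exact h'
    · exact absurd h (rankAbove_lt L hm h').ne
  have img : L.image (rankAbove L) = Finset.range L.card := by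
    refine Finset.eq_of_subset_of_card_le (fun k hk => ?_) ?_
    · obtain ⟨n, hn, rfl⟩ := Finset.mem_image.1 hk
      exact Finset.mem_range.2 (Finset.card_lt_card
        (Finset.filter_ssubset.2 ⟨n, hn, lt_irrefl n⟩))
    · rw [Finset.card_image_of_injOn inj, Finset.card_range]
  rw [← img, Finset.filter_image, Finset.card_image_of_injOn]
  exact inj.mono fun n hn => (Finset.mem_filter.1 hn).1

/-- If the coefficients of a trigonometric polynomial are at least `1/2` on `L` and vanish far
from `L`, then `L` is bounded in terms of the `L¹` norm. -/
lemma card_le_of_mean_norm_le (L T : Finset ℤ) (D : ℕ) (c : ℤ → ℂ)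
    (hc : ∀ l ∈ L, 1 / 2 ≤ ‖c l‖) (hLT : L ⊆ T) (hT : ∀ n ∈ T, ∃ l ∈ L, n ≤ l + D ∧ l ≤ n + D)
    {B : ℝ} (hB : mean (fun θ => ‖∑ n ∈ T, c n * character (-n) θ‖) ≤ B) {K : ℕ}
    (hK : 36 * B ^ 2 * (2 * D + 1) ^ 4 < K) : L.card ≤ 64 ^ K := by
  by_contra! hcard
  set a : ℕ → ℕ := fun j => ∑ i ∈ Finset.range j, 64 ^ i with ha
  have ha_succ : ∀ i, a (i + 1) = a i + 64 ^ i := fun i => Finset.sum_range_succ _ _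
  have ha_mono : Monotone a := monotone_nat_of_le_succ fun i => by rw [ha_succ]; lia
  have haK : a K ≤ L.card := (Nat.geomSum_lt (m := 64) (n := K) (by norm_num)
    (s := Finset.range K) (by simp)).le.trans hcard.le
  set E : ℕ → Finset ℤ := fun i =>
    T.filter fun n => a i ≤ rankAbove L n ∧ rankAbove L n < a (i + 1) with hE
  have hEL : ∀ i < K, 64 ^ i ≤ ((E i).filter (· ∈ L)).card := fun i hi => by
    have h1 : L.filter (fun n => a i ≤ rankAbove L n ∧ rankAbove L n < a (i + 1)) ⊆
        (E i).filter (· ∈ L) := fun n hn => by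
      simp only [hE, Finset.mem_filter] at hn ⊢
      exact ⟨⟨hLT hn.1, hn.2⟩, hn.1⟩
    refine le_trans ?_ (Finset.card_le_card h1)
    rw [card_filter_rankAbove L fun k => a i ≤ k ∧ k < a (i + 1)]
    have h2 : Finset.Ico (a i) (a (i + 1)) ⊆
        (Finset.range L.card).filter fun k => a i ≤ k ∧ k < a (i + 1) := fun k hk => by
      rw [Finset.mem_Ico] at hk
      rw [Finset.mem_filter, Finset.mem_range]
      exact ⟨hk.2.trans_le ((ha_mono (Nat.succ_le_of_lt hi)).trans haK), hk⟩
    refine le_trans ?_ (Finset.card_le_card h2)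
    rw [Nat.card_Ico, ha_succ]; lia
  have hEcard : ∀ i, ((E i).card : ℝ) ≤ ((2 * D + 1 : ℝ) ^ 2) * 64 ^ i := fun i => by
    set L' := L.filter fun n => a i ≤ rankAbove L n + D ∧ rankAbove L n < a (i + 1) + D with hL'
    have hL'card : L'.card ≤ 64 ^ i + 2 * D := by
      rw [hL', card_filter_rankAbove L fun k => a i ≤ k + D ∧ k < a (i + 1) + D]
      refine (Finset.card_le_card (t := Finset.Ico (a i - D) (a (i + 1) + D)) fun k hk => ?_).trans
        ?_
      · simp only [Finset.mem_filter] at hk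
        rw [Finset.mem_Ico]; lia
      · rw [Nat.card_Ico, ha_succ]; lia
    have hsub : E i ⊆ L'.biUnion fun l => Finset.Icc (l - D) (l + D) := fun n hn => by
      simp only [hE, Finset.mem_filter] at hn
      obtain ⟨l, hl, h1, h2⟩ := hT n hn.1
      have h3 := rankAbove_le_add L D h1
      have h4 := rankAbove_le_add L D h2
      rw [Finset.mem_biUnion]
      refine ⟨l, ?_, by rw [Finset.mem_Icc]; lia⟩
      rw [hL', Finset.mem_filter]
      refine ⟨hl, ?_, ?_⟩ <;> lia
    have h1 : (E i).card ≤ L'.card * (2 * D + 1) :=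
      (Finset.card_le_card hsub).trans (Finset.card_biUnion_le_card_mul _ _ _ fun l _ => by
        rw [Int.card_Icc]; lia)
    have h2 : (E i).card ≤ (2 * D + 1) ^ 2 * 64 ^ i := by
      refine h1.trans ?_
      have h3 : 64 ^ i + 2 * D ≤ (2 * D + 1) * 64 ^ i := by
        nlinarith [Nat.one_le_pow i 64 (by norm_num)]
      calc L'.card * (2 * D + 1) ≤ ((2 * D + 1) * 64 ^ i) * (2 * D + 1) :=
            Nat.mul_le_mul_right _ (hL'card.trans h3)
        _ = _ := by ring
    exact_mod_cast h2
  have hord : ∀ i j, i < j → ∀ x ∈ E i, ∀ y ∈ E j, y < x := fun i j hij x hx y hy => by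
    simp only [hE, Finset.mem_filter] at hx hy
    by_contra! hxy
    have := rankAbove_anti L hxy
    have := ha_mono (Nat.succ_le_of_lt hij)
    simp only [Nat.succ_eq_add_one] at this
    lia
  have hTE : ∀ n ∈ T, (∃ i < K, n ∈ E i) ∨ ∀ i < K, ∀ y ∈ E i, n < y := fun n hn => by
    rcases lt_or_ge (rankAbove L n) (a K) with h | h
    · left
      have hex : ∃ i, rankAbove L n < a i := ⟨K, h⟩
      classical
      obtain ⟨i, hi⟩ : ∃ i, Nat.find hex = i + 1 := Nat.exists_eq_succ_of_ne_zero fun h0 => by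
        have := Nat.find_spec hex
        rw [h0] at this; simp [ha] at this
      have h1 := Nat.find_spec hex
      have h2 := Nat.find_min hex (m := i) (by lia)
      have h3 := Nat.find_min' hex h
      rw [hi] at h1
      exact ⟨i, by lia, by simp only [hE, Finset.mem_filter]; exact ⟨hn, by lia, h1⟩⟩
    · right
      intro i hi y hy
      simp only [hE, Finset.mem_filter] at hy
      by_contra! hxy
      have := rankAbove_anti L hxy
      have := ha_mono (Nat.succ_le_of_lt hi)
      simp only [Nat.succ_eq_add_one] at this
      lia
  have key := sum_block_le K E (by positivity) hEcard hord T c hTE fun i => Finset.filter_subset _ _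
  have hlow : ∀ i ∈ Finset.range K, ((2 * D + 1 : ℝ) ^ 2)⁻¹ / 2 ≤
      ((2 * D + 1 : ℝ) ^ 2 * 64 ^ i)⁻¹ * ∑ n ∈ E i, ‖c n‖ := fun i hi => by
    have h1 : (64 : ℝ) ^ i * (1 / 2) ≤ ∑ n ∈ E i, ‖c n‖ := by
      calc (64 : ℝ) ^ i * (1 / 2) ≤ (((E i).filter (· ∈ L)).card : ℝ) * (1 / 2) := by
            gcongr; exact_mod_cast hEL i (Finset.mem_range.1 hi)
        _ ≤ ∑ n ∈ (E i).filter (· ∈ L), ‖c n‖ := by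
            rw [← nsmul_eq_mul]
            exact Finset.card_nsmul_le_sum _ _ _ fun n hn => hc n (Finset.mem_filter.1 hn).2
        _ ≤ _ := Finset.sum_le_sum_of_subset_of_nonneg (Finset.filter_subset _ _)
            fun _ _ _ => norm_nonneg _
    calc ((2 * D + 1 : ℝ) ^ 2)⁻¹ / 2 =
        ((2 * D + 1 : ℝ) ^ 2 * 64 ^ i)⁻¹ * ((64 : ℝ) ^ i * (1 / 2)) := by
          rw [mul_inv]; field_simp
      _ ≤ _ := by gcongr
  have hsum := (Finset.card_nsmul_le_sum _ _ _ hlow).trans key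
  rw [Finset.card_range, nsmul_eq_mul] at hsum
  have hB0 : 0 ≤ B := (mean_nonneg fun θ => norm_nonneg _).trans hB
  have hKpos : (0 : ℝ) < K := lt_of_le_of_lt (by positivity) hK
  set N₀ := (2 * D + 1 : ℝ) ^ 2 with hN₀
  have hN₀pos : 0 < N₀ := by positivity
  have h1 : (K : ℝ) * (N₀⁻¹ / 2) ≤ 3 * √K * B := hsum.trans (by gcongr)
  have h2 : (K : ℝ) = √K * √K := (Real.mul_self_sqrt hKpos.le).symm
  have h3 : 0 < √(K : ℝ) := Real.sqrt_pos.2 hKpos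
  have h4 : √(K : ℝ) ≤ 6 * B * N₀ := by
    have h5 : √(K : ℝ) * (√K * (N₀⁻¹ / 2)) ≤ √K * (3 * B) := by
      rw [← mul_assoc, ← h2]; linarith
    have h6 := le_of_mul_le_mul_left h5 h3
    have h7 := mul_le_mul_of_nonneg_right h6 (by positivity : 0 ≤ 2 * N₀)
    have h8 : √(K : ℝ) * (N₀⁻¹ / 2) * (2 * N₀) = √K := by field_simp
    linarith
  have h5 : (K : ℝ) ≤ (6 * B * N₀) ^ 2 := by
    rw [h2, ← pow_two]; gcongr
  have h6 : (6 * B * N₀) ^ 2 = 36 * B ^ 2 * (2 * D + 1) ^ 4 := by rw [hN₀]; ring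
  linarith

/-- If the image of a bounded integer sequence under a recurrence with leading coefficient `1` is
smaller than `1/2` on a long stretch, then the sequence is eventually periodic on that stretch. -/
lemma exists_period_of_recurrence_small (y : ℤ → ℤ) (Q d T₀ : ℕ) (hy : ∀ n, |y n| ≤ Q)
    (hT₀ : (2 * Q + 1) ^ d ≤ T₀) (p : ℕ → ℝ) (hp : p 0 = 1) (s e : ℤ)
    (hsmall : ∀ n, s + d ≤ n → n ≤ e → |∑ j ∈ Finset.range (d + 1), p j * y (n - j)| < 1 / 2) :
    ∃ T : ℕ, 0 < T ∧ T ≤ T₀ ∧ ∀ n, s + T₀ ≤ n → n + T ≤ e → y (n + T) = y n := by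
  have hmem : ∀ t : ℤ, ∀ i : Fin d, y (t + i) ∈ Finset.Icc (-Q : ℤ) Q := fun t i => by
    rw [Finset.mem_Icc]; exact abs_le.1 (hy _)
  obtain ⟨t₁, ht₁, t₂, ht₂, hne, heq⟩ := Finset.exists_ne_map_eq_of_card_lt_of_maps_to
    (s := Finset.range (T₀ + 1))
    (t := Fintype.piFinset fun _ : Fin d => Finset.Icc (-Q : ℤ) Q)
    (f := fun t i => y (s + t + i))
    (by
      rw [Fintype.card_piFinset_const, Int.card_Icc, Finset.card_range]
      have : (Q + 1 - -Q : ℤ).toNat = 2 * Q + 1 := by lia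
      rw [this]; lia)
    (fun t _ => Finset.mem_coe.2 (Fintype.mem_piFinset.2 fun i => hmem _ i))
  wlog hlt : t₁ < t₂ generalizing t₁ t₂
  · exact this t₂ ht₂ t₁ ht₁ hne.symm heq.symm (by lia)
  rw [Finset.mem_range] at ht₁ ht₂
  refine ⟨t₂ - t₁, by lia, by lia, ?_⟩
  have main : ∀ m : ℕ, s + t₁ + m + (t₂ - t₁ : ℕ) ≤ e →
      y (s + t₁ + m + (t₂ - t₁ : ℕ)) = y (s + t₁ + m) := fun m => by
    induction m using Nat.strong_induction_on with
    | _ m ih =>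
      intro hm
      rcases lt_or_ge m d with hmd | hmd
      · have h := congrFun heq ⟨m, hmd⟩
        simp only at h
        rw [h]
        congr 1; lia
      · have hT := hsmall (s + t₁ + m + (t₂ - t₁ : ℕ)) (by lia) hm
        have h0 := hsmall (s + t₁ + m) (by lia) (by lia)
        rw [Finset.sum_range_succ'] at hT h0
        have hrest : ∑ j ∈ Finset.range d,
              p (j + 1) * (y (s + t₁ + m + (t₂ - t₁ : ℕ) - (j + 1 : ℕ)) : ℝ) =
            ∑ j ∈ Finset.range d, p (j + 1) * (y (s + t₁ + m - (j + 1 : ℕ)) : ℝ) := by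
          refine Finset.sum_congr rfl fun j hj => ?_
          rw [Finset.mem_range] at hj
          have h := ih (m - (j + 1)) (by lia) (by lia)
          congr 2
          convert h using 2 <;> lia
        rw [hrest] at hT
        simp only [hp, one_mul, Nat.cast_zero, sub_zero] at hT h0
        have hlt : |(y (s + t₁ + m + (t₂ - t₁ : ℕ)) - y (s + t₁ + m) : ℝ)| < 1 := by
          rw [abs_lt] at hT h0 ⊢
          constructor <;> linarith
        have hlt' : |y (s + t₁ + m + (t₂ - t₁ : ℕ)) - y (s + t₁ + m)| < 1 := by exact_mod_cast hlt
        exact sub_eq_zero.1 (Int.abs_lt_one_iff.1 hlt')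
  intro n hn hne
  have h := main (n - s - t₁).toNat (by lia)
  convert h using 2 <;> lia

/-- A long difference of a bounded integer sequence vanishes at the end of every long stretch on
which a recurrence applied to it is smaller than `1/2`. -/
lemma eq_zero_of_recurrence_small (a : ℤ → ℤ) (Q d T₀ : ℕ) (ha : ∀ m n, |a m - a n| ≤ Q)
    (hT₀ : (2 * Q + 1) ^ d ≤ T₀) (p : ℕ → ℝ) (hp : p 0 = 1) (e : ℤ)
    (hsmall : ∀ n, e - (Q * T₀.factorial + T₀ : ℕ) ≤ n → n ≤ e →
      |∑ j ∈ Finset.range (d + 1),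
        p j * ((a (n - j) - a (n - j - T₀.factorial) : ℤ) : ℝ)| < 1 / 2) :
    a e = a (e - T₀.factorial) := by
  set W := T₀.factorial with hW
  set y : ℤ → ℤ := fun n => a n - a (n - W) with hy
  obtain ⟨T, hT0, hT, hper⟩ := exists_period_of_recurrence_small y Q d T₀ (fun n => ha _ _) hT₀ p hp
    (e - (Q * W + T₀ : ℕ)) e (fun n h1 h2 => hsmall n (by lia) h2)
  obtain ⟨m, hm⟩ : T ∣ W := Nat.dvd_factorial hT0 hT
  have iter : ∀ j : ℕ, j * T ≤ Q * W → y (e - (j * T : ℕ)) = y e := fun j => by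
    induction j with
    | zero => simp
    | succ j ih =>
      intro hj
      rw [← ih (by lia), ← hper (e - ((j + 1) * T : ℕ)) (by lia) (by lia)]
      congr 1; lia
  have tele : ∀ j : ℕ, j ≤ Q + 1 → a e - a (e - (j * W : ℕ)) = j * y e := fun j => by
    induction j with
    | zero => simp
    | succ j ih =>
      intro hj
      have h1 := ih (by lia)
      have h2 := iter (j * m) (by
        rw [mul_assoc, mul_comm m, ← hm]; exact Nat.mul_le_mul_right _ (by lia))
      rw [mul_assoc, mul_comm m, ← hm] at h2
      have h3 : y (e - (j * W : ℕ)) = a (e - (j * W : ℕ)) - a (e - ((j + 1) * W : ℕ)) := by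
        rw [hy]; simp only; congr 2; push_cast; ring
      rw [h3] at h2
      push_cast at h1 h2 ⊢
      linarith
  have h := tele (Q + 1) le_rfl
  have h1 := ha e (e - ((Q + 1) * W : ℕ))
  rw [h, abs_mul] at h1
  by_contra hne
  have h2 : 1 ≤ |y e| := Int.one_le_abs (sub_ne_zero.2 hne)
  rw [abs_of_nonneg (by positivity)] at h1
  push_cast at h1
  nlinarith

section

open Polynomial

/-- A real polynomial becomes of constant sign on `[-1, 1]` after multiplication by suitable
linear factors vanishing at some of its roots. -/
lemma exists_sign_correction (q : ℝ[X]) (hq : q ≠ 0) :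
    ∃ S : Finset ℝ, (∀ r ∈ S, q.IsRoot r ∧ r ∈ Set.Ioo (-1) 1) ∧
      ((∀ x ∈ Set.Icc (-1) 1, 0 ≤ q.eval x * ∏ r ∈ S, (x - r)) ∨
        ∀ x ∈ Set.Icc (-1) 1, q.eval x * ∏ r ∈ S, (x - r) ≤ 0) := by
  induction hn : q.natDegree generalizing q with
  | zero =>
    refine ⟨∅, by simp, ?_⟩
    rw [eq_C_of_natDegree_eq_zero hn]
    simp only [eval_C, Finset.prod_empty, mul_one]
    rcases le_total 0 (q.coeff 0) with h | h
    · exact Or.inl fun _ _ => h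
    · exact Or.inr fun _ _ => h
  | succ n ih =>
    by_cases hroot : ∃ r ∈ Set.Ioo (-1 : ℝ) 1, q.IsRoot r
    · obtain ⟨r, hr, hqr⟩ := hroot
      obtain ⟨g, rfl⟩ := dvd_iff_isRoot.2 hqr
      have hg : g ≠ 0 := right_ne_zero_of_mul hq
      have hdeg : g.natDegree = n := by
        rw [natDegree_mul (X_sub_C_ne_zero r) hg, natDegree_X_sub_C] at hn; lia
      obtain ⟨S, hS, hsign⟩ := ih g hg hdeg
      have hS' : ∀ t ∈ S, ((X - C r) * g).IsRoot t ∧ t ∈ Set.Ioo (-1) 1 := fun t ht =>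
        ⟨root_mul_left_of_isRoot _ (hS t ht).1, (hS t ht).2⟩
      by_cases hrS : r ∈ S
      · refine ⟨S.erase r, fun t ht => hS' t (Finset.mem_of_mem_erase ht), ?_⟩
        have : ∀ x, ((X - C r) * g).eval x * ∏ t ∈ S.erase r, (x - t) =
            g.eval x * ∏ t ∈ S, (x - t) := fun x => by
          rw [← Finset.mul_prod_erase S _ hrS]; simp; ring
        simpa only [this] using hsign
      · refine ⟨insert r S, fun t ht => ?_, ?_⟩
        · rcases Finset.mem_insert.1 ht with rfl | ht
          · exact ⟨hqr, hr⟩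
          · exact hS' t ht
        have : ∀ x, ((X - C r) * g).eval x * ∏ t ∈ insert r S, (x - t) =
            g.eval x * (∏ t ∈ S, (x - t)) * (x - r) ^ 2 := fun x => by
          rw [Finset.prod_insert hrS]; simp; ring
        simp only [this]
        exact hsign.imp (fun h x hx => mul_nonneg (h x hx) (sq_nonneg _))
          fun h x hx => mul_nonpos_of_nonpos_of_nonneg (h x hx) (sq_nonneg _)
    · refine ⟨∅, by simp, ?_⟩
      simp only [Finset.prod_empty, mul_one]
      push Not at hroot
      have hc : ContinuousOn (fun x => q.eval x) (Set.Ioo (-1) 1) := q.continuous.continuousOn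
      have hcl : closure (Set.Ioo (-1 : ℝ) 1) = Set.Icc (-1) 1 := closure_Ioo (by norm_num)
      rw [← hcl]
      by_cases hpos : ∃ x ∈ Set.Ioo (-1 : ℝ) 1, 0 < q.eval x
      · obtain ⟨x, hx, hx0⟩ := hpos
        left
        refine closure_minimal (t := {y | 0 ≤ q.eval y}) (fun y hy => ?_)
          (isClosed_le continuous_const q.continuous)
        by_contra hneg
        obtain ⟨z, hz, hz0⟩ := isPreconnected_Ioo.intermediate_value hy hx hc
          ⟨(not_le.1 hneg).le, hx0.le⟩
        exact hroot z hz hz0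
      · push Not at hpos
        right
        exact closure_minimal (t := {y | q.eval y ≤ 0}) hpos
          (isClosed_le q.continuous continuous_const)

lemma sum_abs_coeff_mul_X_le (q : ℝ[X]) (n : ℕ) :
    ∑ j ∈ Finset.range n, |(q * X).coeff j| ≤ ∑ j ∈ Finset.range n, |q.coeff j| := by
  cases n with
  | zero => simp
  | succ n =>
    rw [Finset.sum_range_succ', Finset.sum_range_succ]
    simp

/-- The polynomial `∏ (X² - 2 r X + 1)`, which is `e^{ikθ} ∏ (2 cos θ - 2 r)` on the circle. -/
noncomputable def cosPoly (S : Finset ℝ) : ℝ[X] := ∏ r ∈ S, (X ^ 2 - C (2 * r) * X + 1)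

lemma natDegree_cosPoly_le (S : Finset ℝ) : (cosPoly S).natDegree ≤ 2 * S.card := by
  refine (natDegree_prod_le _ _).trans ?_
  rw [mul_comm, ← smul_eq_mul]
  exact Finset.sum_le_card_nsmul _ _ _ fun r _ => by compute_degree

lemma coeff_zero_cosPoly (S : Finset ℝ) : (cosPoly S).coeff 0 = 1 := by
  rw [cosPoly, coeff_zero_prod]
  exact Finset.prod_eq_one fun r _ => by simp

lemma sum_abs_coeff_cosPoly_le (S : Finset ℝ) (hS : ∀ r ∈ S, |r| ≤ 1) (n : ℕ) :
    ∑ j ∈ Finset.range n, |(cosPoly S).coeff j| ≤ 4 ^ S.card := by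
  classical
  induction S using Finset.induction_on with
  | empty =>
    simp only [cosPoly, Finset.prod_empty, Finset.card_empty, pow_zero, coeff_one, abs_ite, abs_one,
      abs_zero]
    rw [Finset.sum_ite_eq']
    split_ifs <;> norm_num
  | insert r S hr ih =>
    have ih := ih fun t ht => hS t (Finset.mem_insert_of_mem ht)
    have hr1 := hS r (Finset.mem_insert_self r S)
    set q := cosPoly S with hq
    have hmul : cosPoly (insert r S) = q * X * X - C (2 * r) * (q * X) + q := by
      rw [hq, cosPoly, Finset.prod_insert hr, ← cosPoly]; ring
    rw [hmul, Finset.card_insert_of_notMem hr, pow_succ]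
    calc ∑ j ∈ Finset.range n, |(q * X * X - C (2 * r) * (q * X) + q).coeff j|
        ≤ ∑ j ∈ Finset.range n, (|(q * X * X).coeff j| + 2 * |(q * X).coeff j| + |q.coeff j|) := by
          refine Finset.sum_le_sum fun j _ => ?_
          rw [coeff_add, coeff_sub, coeff_C_mul]
          refine (abs_add_le _ _).trans (add_le_add_left ((abs_sub _ _).trans ?_) _)
          rw [abs_mul, abs_mul, abs_two]
          nlinarith [abs_nonneg ((q * X).coeff j)]
      _ = ∑ j ∈ Finset.range n, |(q * X * X).coeff j| +
          2 * ∑ j ∈ Finset.range n, |(q * X).coeff j| +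
          ∑ j ∈ Finset.range n, |q.coeff j| := by
          rw [Finset.sum_add_distrib, Finset.sum_add_distrib, Finset.mul_sum]
      _ ≤ _ := by
          have h1 := sum_abs_coeff_mul_X_le (q * X) n
          have h2 := sum_abs_coeff_mul_X_le q n
          linarith

lemma aeval_cosPoly (S : Finset ℝ) (θ : ℝ) :
    aeval (character 1 θ) (cosPoly S) =
      character S.card θ * ((∏ r ∈ S, (2 * (Real.cos θ - r)) : ℝ) : ℂ) := by
  rw [cosPoly, map_prod, character_eq_zpow S.card, zpow_natCast, ← Finset.prod_const]
  push_cast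
  rw [← Finset.prod_mul_distrib]
  refine Finset.prod_congr rfl fun r _ => ?_
  have h1 : character 1 θ * character (-1) θ = 1 := by
    rw [← character_add, add_neg_cancel, character_zero]
  have h2 : 2 * Complex.cos θ = character 1 θ + character (-1) θ := by
    rw [Complex.two_cos]; simp [character]
  simp only [map_add, map_sub, map_mul, map_pow, aeval_X, aeval_C, map_one]
  rw [mul_sub 2, h2]
  simp only [Complex.coe_algebraMap]
  push_cast
  linear_combination (-1 : ℂ) * h1

lemma finite_zeros_comp_cos (q : ℝ[X]) (hq : q ≠ 0) :
    {θ : ℝ | θ ∈ Set.Icc 0 (2 * Real.pi) ∧ q.eval (Real.cos θ) = 0}.Finite := by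
  refine Set.Finite.subset (s := (Real.arccos '' {x | q.IsRoot x}) ∪
    ((fun x => 2 * Real.pi - Real.arccos x) '' {x | q.IsRoot x})) ?_ fun θ hθ => ?_
  · exact ((finite_setOfPred_isRoot hq).image _).union ((finite_setOfPred_isRoot hq).image _)
  · obtain ⟨⟨h0, h2⟩, hz⟩ := hθ
    rcases le_total θ Real.pi with h | h
    · exact Or.inl ⟨_, hz, Real.arccos_cos h0 h⟩
    · refine Or.inr ⟨_, hz, ?_⟩
      have := Real.arccos_cos (x := 2 * Real.pi - θ) (by linarith) (by linarith)
      rw [Real.cos_two_pi_sub] at this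
      simp only [this]; ring

lemma card_le_ncard_zeros (q : ℝ[X]) (hq : q ≠ 0) (S : Finset ℝ)
    (hS : ∀ r ∈ S, q.IsRoot r ∧ r ∈ Set.Ioo (-1) 1) :
    S.card ≤ {θ : ℝ | θ ∈ Set.Icc 0 (2 * Real.pi) ∧ q.eval (Real.cos θ) = 0}.ncard := by
  have hcos : ∀ r ∈ S, Real.cos (Real.arccos r) = r := fun r hr =>
    Real.cos_arccos (hS r hr).2.1.le (hS r hr).2.2.le
  rw [← Set.ncard_coe_finset]
  refine Set.ncard_le_ncard_of_injOn Real.arccos (fun r hr => ?_) (fun r hr t ht h => ?_)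
    (finite_zeros_comp_cos q hq)
  · refine ⟨⟨Real.arccos_nonneg r, (Real.arccos_le_pi r).trans (by linarith [Real.pi_pos])⟩, ?_⟩
    rw [hcos r hr]; exact (hS r hr).1
  · rw [← hcos r hr, h, hcos t ht]

lemma exists_eval_cos_eq (N : ℕ) (A : ℕ → ℤ) :
    ∃ q : ℝ[X], ∀ θ, q.eval (Real.cos θ) =
      ∑ n ∈ Finset.range (N + 1), (A n : ℝ) * Real.cos (n * θ) := by
  refine ⟨∑ n ∈ Finset.range (N + 1), C (A n : ℝ) * Chebyshev.T ℝ n, fun θ => ?_⟩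
  rw [eval_finsetSum]
  refine Finset.sum_congr rfl fun n _ => ?_
  rw [eval_mul, eval_C, Chebyshev.T_real_cos]; simp

end

/-- The trigonometric polynomial with coefficients `y`, for finitely supported `y`. -/
noncomputable def charSum (y : ℤ → ℂ) (θ : ℝ) : ℂ := ∑' n, y n * character n θ

lemma charSum_eq_sum {y : ℤ → ℂ} {T : Finset ℤ} (hT : ∀ n ∉ T, y n = 0) (θ : ℝ) :
    charSum y θ = ∑ n ∈ T, y n * character n θ :=
  tsum_eq_sum fun n hn => by rw [hT n hn, zero_mul]

lemma continuous_charSum {y : ℤ → ℂ} (hy : y.support.Finite) : Continuous (charSum y) := by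
  have h : ∀ n ∉ hy.toFinset, y n = 0 := by simp
  rw [funext (charSum_eq_sum h)]; fun_prop

lemma finite_support_convolution {ι 𝕜 : Type*} [Semiring 𝕜] (J : Finset ι) (p : ι → 𝕜) (s : ι → ℤ)
    {y : ℤ → 𝕜} (hy : y.support.Finite) :
    (Function.support fun n => ∑ j ∈ J, p j * y (n - s j)).Finite := by
  refine Set.Finite.subset (J.finite_toSet.biUnion fun j _ => hy.image (· + s j)) fun n hn => ?_
  obtain ⟨j, hj, hne⟩ := Finset.exists_ne_zero_of_sum_ne_zero (Function.mem_support.1 hn)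
  exact Set.mem_biUnion (Finset.mem_coe.2 hj)
    ⟨n - s j, Function.mem_support.2 (right_ne_zero_of_mul hne), by simp⟩

lemma sum_character_mul_charSum {ι : Type*} (J : Finset ι) (p : ι → ℂ) (s : ι → ℤ) {y : ℤ → ℂ}
    (hy : y.support.Finite) (θ : ℝ) :
    (∑ j ∈ J, p j * character (s j) θ) * charSum y θ =
      charSum (fun n => ∑ j ∈ J, p j * y (n - s j)) θ := by
  have hsum : ∀ j, Summable fun n => y (n - s j) * character (n - s j) θ := fun j =>
    summable_of_hasFiniteSupport <| ((hy.image (· + s j)).subset fun n hn =>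
      ⟨n - s j, Function.mem_support.2 (left_ne_zero_of_mul hn), by simp⟩)
  have hterm : ∀ n j, p j * y (n - s j) * character n θ =
      p j * character (s j) θ * (y (n - s j) * character (n - s j) θ) := fun n j => by
    have : character n θ = character (s j) θ * character (n - s j) θ := by
      rw [← character_add, add_sub_cancel]
    rw [this]; ring
  rw [charSum, charSum]
  simp_rw [Finset.sum_mul _ _ (character _ θ), hterm]
  rw [Summable.tsum_finsetSum fun j _ => (hsum j).mul_left _, Finset.sum_mul]
  refine Finset.sum_congr rfl fun j _ => ?_
  rw [tsum_mul_left, ← (Equiv.subRight (s j)).tsum_eq fun n => y n * character n θ]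
  rfl

lemma mean_charSum_mul_character {y : ℤ → ℂ} (hy : y.support.Finite) (m : ℤ) :
    mean (fun θ => charSum y θ * character (-m) θ) = y m := by
  have h : ∀ n ∉ hy.toFinset, y n = 0 := by simp
  have h2 : ∀ θ, charSum y θ * character (-m) θ =
      ∑ n ∈ hy.toFinset, y n * character (n - m) θ := fun θ => by
    rw [charSum_eq_sum h, Finset.sum_mul]
    refine Finset.sum_congr rfl fun n _ => ?_
    rw [mul_assoc, ← character_add, sub_eq_add_neg]
  rw [funext h2, mean_sum _ fun n _ => by fun_prop]
  simp_rw [mean_const_mul, mean_character, sub_eq_zero, mul_ite, mul_one, mul_zero]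
  rw [Finset.sum_ite_eq']
  split_ifs with hm
  · rfl
  · exact (h m hm).symm

lemma norm_sum_ofReal_mul_character_neg (T : Finset ℤ) (c : ℤ → ℝ) (θ : ℝ) :
    ‖∑ n ∈ T, (c n : ℂ) * character (-n) θ‖ = ‖∑ n ∈ T, (c n : ℂ) * character n θ‖ := by
  rw [← RCLike.norm_conj, map_sum]
  simp [character_neg]

/-- If multiplying a trigonometric polynomial with integer coefficients by a fixed polynomial
gives small `L¹` norm, then its coefficients are almost periodic with few exceptions. -/
lemma ncard_ne_shift_le (a : ℤ → ℤ) (hfin : a.support.Finite) (Q d T₀ : ℕ)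
    (ha : ∀ m n, |a m - a n| ≤ Q) (hT₀ : (2 * Q + 1) ^ d ≤ T₀) (p : ℕ → ℝ) (hp : p 0 = 1) {B : ℝ}
    (hB : mean (fun θ => ‖(∑ j ∈ Finset.range (d + 1), (p j : ℂ) * character j θ) *
      charSum (fun n => (a n : ℂ)) θ‖) ≤ B) {D K : ℕ} (hD : D = Q * T₀.factorial + T₀)
    (hK : 36 * (2 * B) ^ 2 * (2 * (D + d : ℕ) + 1) ^ 4 < K) :
    {n | a n ≠ a (n - T₀.factorial)}.Finite ∧
      {n | a n ≠ a (n - T₀.factorial)}.ncard ≤ (D + 1) * 64 ^ K := by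
  set W := T₀.factorial with hW
  set y : ℤ → ℤ := fun n => a n - a (n - W) with hy
  set G : ℤ → ℝ := fun n => ∑ j ∈ Finset.range (d + 1), p j * (y (n - j) : ℝ) with hG
  have hafin : (fun n => (a n : ℂ)).support.Finite := hfin.subset fun n hn => by
    simpa using hn
  have hyfin : y.support.Finite := by
    refine (hfin.union (hfin.image (· + (W : ℤ)))).subset fun n hn => ?_
    by_contra hcon
    simp only [Set.mem_union, not_or, Set.mem_image, not_exists, not_and] at hcon
    have h1 : a n = 0 := by simpa using hcon.1
    have h2 : a (n - W) = 0 := by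
      by_contra h; exact hcon.2 (n - W) h (by ring)
    exact hn (by simp [hy, h1, h2])
  have hyRfin : (fun n => (y n : ℝ)).support.Finite := hyfin.subset fun n hn => by simpa using hn
  have hyCfin : (fun n => (y n : ℂ)).support.Finite := hyfin.subset fun n hn => by simpa using hn
  have hGfin : G.support.Finite := finite_support_convolution _ p (fun j : ℕ => (j : ℤ)) hyRfin
  set T := hGfin.toFinset with hT
  have hTmem : ∀ n, n ∈ T ↔ G n ≠ 0 := by simp [hT]
  set L := T.filter fun n => 1 / 2 ≤ |G n| with hL
  have hLmem : ∀ n, n ∈ L ↔ 1 / 2 ≤ |G n| := fun n => by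
    rw [hL, Finset.mem_filter, hTmem]
    refine ⟨fun h => h.2, fun h => ⟨fun h0 => ?_, h⟩⟩
    rw [h0, abs_zero] at h; linarith
  have hnear : ∀ n, y n ≠ 0 → ∃ l ∈ L, l ≤ n ∧ n ≤ l + D := fun n hn => by
    by_contra! hcon
    refine hn (sub_eq_zero.2 (eq_zero_of_recurrence_small a Q d T₀ ha hT₀ p hp n fun m h1 h2 => ?_))
    by_contra! hge
    have := hcon m ((hLmem m).2 hge) h2
    lia
  have hsub : {n | a n ≠ a (n - W)} ⊆ ↑(L.biUnion fun l => Finset.Icc l (l + D)) := fun n hn => by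
    obtain ⟨l, hl, h1, h2⟩ := hnear n (sub_ne_zero.2 hn)
    exact Finset.mem_coe.2 (Finset.mem_biUnion.2 ⟨l, hl, Finset.mem_Icc.2 ⟨h1, h2⟩⟩)
  refine ⟨(Finset.finite_toSet _).subset hsub, ?_⟩
  have hcharG : ∀ θ, charSum (fun n => (G n : ℂ)) θ = (1 - character W θ) *
      ((∑ j ∈ Finset.range (d + 1), (p j : ℂ) * character j θ) *
      charSum (fun n => (a n : ℂ)) θ) := fun θ => by
    have h1 := sum_character_mul_charSum (Finset.range (d + 1)) (fun j => (p j : ℂ))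
      (fun j : ℕ => (j : ℤ)) hyCfin θ
    have h2 := sum_character_mul_charSum (Finset.univ : Finset (Fin 2)) ![1, -1]
      ![0, (W : ℤ)] hafin θ
    simp only [Fin.sum_univ_two, Matrix.cons_val_zero, Matrix.cons_val_one, character_zero,
      sub_zero, one_mul, neg_one_mul, ← sub_eq_add_neg] at h2
    have h3 : (fun n => (a n : ℂ) - (a (n - W) : ℂ)) = fun n => (y n : ℂ) := by
      ext n; simp [hy]
    rw [h3] at h2
    rw [mul_left_comm, h2, h1]
    congr 1; ext n; simp [hG]
  have hmean : mean (fun θ => ‖∑ n ∈ T, (G n : ℂ) * character (-n) θ‖) ≤ 2 * B := by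
    have h1 : ∀ θ, ‖∑ n ∈ T, (G n : ℂ) * character (-n) θ‖ = ‖charSum (fun n => (G n : ℂ)) θ‖ :=
      fun θ => by
        rw [norm_sum_ofReal_mul_character_neg, charSum_eq_sum fun n hn => ?_]
        simpa [hTmem] using hn
    have hGC : (fun n => (G n : ℂ)).support.Finite := hGfin.subset fun n hn => by simpa using hn
    have hac := continuous_charSum hafin
    calc _ = mean (fun θ => ‖charSum (fun n => (G n : ℂ)) θ‖) := by rw [funext h1]
      _ ≤ mean (fun θ => 2 * ‖(∑ j ∈ Finset.range (d + 1), (p j : ℂ) * character j θ) *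
          charSum (fun n => (a n : ℂ)) θ‖) := by
        refine mean_mono (continuous_charSum hGC).norm (by fun_prop) fun θ => ?_
        rw [hcharG, norm_mul]
        gcongr
        refine (norm_sub_le _ _).trans ?_
        rw [norm_character, norm_one]; norm_num
      _ ≤ 2 * B := by rw [mean_const_mul]; gcongr
  have hLcard : L.card ≤ 64 ^ K := by
    refine card_le_of_mean_norm_le L T (D + d) (fun n => (G n : ℂ)) (fun l hl => ?_)
      (Finset.filter_subset _ _) (fun n hn => ?_) hmean hK
    · rw [Complex.norm_real]; exact (hLmem l).1 hl
    · obtain ⟨j, hj, hne⟩ := Finset.exists_ne_zero_of_sum_ne_zero ((hTmem n).1 hn)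
      have hyj : y (n - j) ≠ 0 := by
        intro h0; rw [h0] at hne; simp at hne
      obtain ⟨l, hl, h1, h2⟩ := hnear _ hyj
      rw [Finset.mem_range] at hj
      exact ⟨l, hl, by push_cast; lia, by push_cast; lia⟩
  calc _ ≤ (L.biUnion fun l => Finset.Icc l (l + D)).card := by
        rw [← Set.ncard_coe_finset]
        exact Set.ncard_le_ncard hsub (Finset.finite_toSet _)
    _ ≤ L.card * (D + 1) := Finset.card_biUnion_le_card_mul _ _ _ fun l _ => by
        rw [Int.card_Icc]; lia
    _ ≤ _ := by rw [mul_comm]; gcongr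

section

open Polynomial

/-- The coefficients of `2 ∑_{n ≤ N} A n cos (n θ)` as an exponential sum. -/
def symmCoeff (N : ℕ) (A : ℕ → ℤ) (m : ℤ) : ℤ :=
  ∑ n ∈ Finset.range (N + 1), ((if m = n then A n else 0) + if m = -n then A n else 0)

lemma symmCoeff_eq_zero (N : ℕ) (A : ℕ → ℤ) {m : ℤ} (hm : m ∉ Finset.Icc (-N : ℤ) N) :
    symmCoeff N A m = 0 := by
  refine Finset.sum_eq_zero fun n hn => ?_
  rw [Finset.mem_range] at hn
  rw [Finset.mem_Icc] at hm
  rw [if_neg (by lia), if_neg (by lia), add_zero]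

lemma finite_support_symmCoeff (N : ℕ) (A : ℕ → ℤ) : (symmCoeff N A).support.Finite :=
  (Finset.finite_toSet (Finset.Icc (-N : ℤ) N)).subset fun _ hm => by
    by_contra h; exact hm (symmCoeff_eq_zero N A h)

lemma abs_symmCoeff_le (N : ℕ) (A : ℕ → ℤ) (M : ℕ) (hA : ∀ n ≤ N, |A n| ≤ M) (m : ℤ) :
    |symmCoeff N A m| ≤ 2 * M := by
  have aux : ∀ k : ℤ, |∑ n ∈ Finset.range (N + 1), if k = n then A n else 0| ≤ M := fun k => by
    by_cases h : ∃ n ∈ Finset.range (N + 1), k = n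
    · obtain ⟨n, hn, rfl⟩ := h
      rw [Finset.sum_eq_single_of_mem n hn fun b _ hb => if_neg (by lia), if_pos rfl]
      exact hA n (by simpa [Nat.lt_succ_iff] using hn)
    · push Not at h
      rw [Finset.sum_eq_zero fun n hn => if_neg (h n hn)]
      simp
  have h1 := aux m
  have h2 := aux (-m)
  simp only [neg_eq_iff_eq_neg] at h2
  rw [symmCoeff, Finset.sum_add_distrib]
  exact (abs_add_le _ _).trans (by linarith)

lemma charSum_symmCoeff (N : ℕ) (A : ℕ → ℤ) (θ : ℝ) :
    charSum (fun n => (symmCoeff N A n : ℂ)) θ =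
      ((2 * ∑ n ∈ Finset.range (N + 1), (A n : ℝ) * Real.cos (n * θ) : ℝ) : ℂ) := by
  rw [charSum_eq_sum (T := Finset.Icc (-N : ℤ) N)
    fun n hn => by rw [symmCoeff_eq_zero N A hn, Int.cast_zero]]
  simp only [symmCoeff]
  push_cast
  simp_rw [Finset.sum_mul, Finset.mul_sum]
  rw [Finset.sum_comm]
  refine Finset.sum_congr rfl fun n hn => ?_
  rw [Finset.mem_range] at hn
  have hcos : 2 * Complex.cos (n * θ) = character n θ + character (-n) θ := by
    rw [Complex.two_cos]; simp [character]
  simp_rw [add_mul, ite_mul, zero_mul]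
  rw [Finset.sum_add_distrib, Finset.sum_ite_eq', Finset.sum_ite_eq',
    if_pos (by rw [Finset.mem_Icc]; lia), if_pos (by rw [Finset.mem_Icc]; lia), mul_left_comm,
    hcos, mul_add]

/-- The `L¹` norm of a cosine polynomial times the polynomial correcting its sign. -/
lemma mean_norm_cosPoly_mul_le (N : ℕ) (A : ℕ → ℤ) (M : ℕ) (hA : ∀ n ≤ N, |A n| ≤ M) (q : ℝ[X])
    (hq : ∀ θ, q.eval (Real.cos θ) = ∑ n ∈ Finset.range (N + 1), (A n : ℝ) * Real.cos (n * θ))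
    (S : Finset ℝ) (hS : ∀ r ∈ S, |r| ≤ 1)
    (hsign : (∀ x ∈ Set.Icc (-1) 1, 0 ≤ q.eval x * ∏ r ∈ S, (x - r)) ∨
        ∀ x ∈ Set.Icc (-1) 1, q.eval x * ∏ r ∈ S, (x - r) ≤ 0) :
    mean (fun θ => ‖(∑ j ∈ Finset.range (2 * S.card + 1),
      ((cosPoly S).coeff j : ℂ) * character j θ) * charSum (fun n => (symmCoeff N A n : ℂ)) θ‖) ≤
      2 * M * 4 ^ S.card := by
  set k := S.card with hk
  set p := cosPoly S with hp
  set a := symmCoeff N A with ha_def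
  set Φ : ℝ → ℝ := fun θ => 2 ^ (k + 1) * (q.eval (Real.cos θ) * ∏ r ∈ S, (Real.cos θ - r))
    with hΦ
  have hΦc : Continuous Φ := by
    rw [hΦ]; have := q.continuous; fun_prop
  have hafin : (fun n => (a n : ℂ)).support.Finite :=
    (finite_support_symmCoeff N A).subset fun n hn => by simpa using hn
  have hprod : ∀ θ, (∑ j ∈ Finset.range (2 * k + 1), (p.coeff j : ℂ) * character j θ) *
      charSum (fun n => (a n : ℂ)) θ = character k θ * (Φ θ : ℂ) := fun θ => by
    have h1 : ∑ j ∈ Finset.range (2 * k + 1), (p.coeff j : ℂ) * character j θ =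
        aeval (character 1 θ) p := by
      rw [aeval_eq_sum_range' (Nat.lt_succ_of_le (natDegree_cosPoly_le S))]
      refine Finset.sum_congr rfl fun j _ => ?_
      rw [character_eq_zpow, zpow_natCast, Complex.real_smul]
    rw [h1, hp, aeval_cosPoly, ha_def, charSum_symmCoeff, ← hq, hΦ, Finset.prod_mul_distrib,
      Finset.prod_const, ← hk, pow_succ]
    push_cast; ring
  have hnorm : ∀ θ, ‖(∑ j ∈ Finset.range (2 * k + 1), (p.coeff j : ℂ) * character j θ) *
      charSum (fun n => (a n : ℂ)) θ‖ = |Φ θ| := fun θ => by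
    rw [hprod, norm_mul, norm_character, one_mul, Complex.norm_real, Real.norm_eq_abs]
  rw [funext hnorm]
  have habs : mean (fun θ => |Φ θ|) = |mean Φ| := by
    have hcos : ∀ θ, Real.cos θ ∈ Set.Icc (-1) 1 := fun θ =>
      ⟨Real.neg_one_le_cos θ, Real.cos_le_one θ⟩
    rcases hsign with h | h
    · have h0 : ∀ θ, 0 ≤ Φ θ := fun θ => mul_nonneg (by positivity) (h _ (hcos θ))
      rw [abs_of_nonneg (mean_nonneg h0)]
      congr 1; ext θ; exact abs_of_nonneg (h0 θ)
    · have h0 : ∀ θ, Φ θ ≤ 0 := fun θ =>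
        mul_nonpos_of_nonneg_of_nonpos (by positivity) (h _ (hcos θ))
      have h1 : ∀ θ, |Φ θ| = (-1) * Φ θ := fun θ => by rw [abs_of_nonpos (h0 θ)]; ring
      have h2 := mean_nonneg (φ := fun θ => |Φ θ|) fun θ => abs_nonneg _
      rw [funext h1, mean_const_mul] at h2 ⊢
      rw [abs_of_nonpos (by linarith)]; ring
  rw [habs]
  have hcoeff : ((mean Φ : ℝ) : ℂ) =
      ∑ j ∈ Finset.range (2 * k + 1), (p.coeff j : ℂ) * a (k - j) := by
    have h1 : ((mean Φ : ℝ) : ℂ) = mean (fun θ => (Φ θ : ℂ)) := by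
      simp only [mean]
      rw [intervalIntegral.integral_ofReal]; simp
    have h2 : ∀ θ, (Φ θ : ℂ) = charSum
        (fun n => ∑ j ∈ Finset.range (2 * k + 1), (p.coeff j : ℂ) * a (n - j)) θ *
        character (-k) θ := fun θ => by
      rw [← sum_character_mul_charSum (y := fun n => (a n : ℂ)) _ _ (fun j : ℕ => (j : ℤ)) hafin,
        hprod, mul_right_comm, ← character_add, add_neg_cancel, character_zero, one_mul]
    rw [h1, funext h2, mean_charSum_mul_character (finite_support_convolution _ _ _ hafin)]
  have hbound := congrArg norm hcoeff
  rw [Complex.norm_real, Real.norm_eq_abs] at hbound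
  rw [hbound]
  calc _ ≤ ∑ j ∈ Finset.range (2 * k + 1), |p.coeff j| * (2 * M) := by
        refine (norm_sum_le _ _).trans (Finset.sum_le_sum fun j _ => ?_)
        rw [norm_mul, Complex.norm_real, Real.norm_eq_abs, Complex.norm_intCast]
        gcongr
        exact_mod_cast abs_symmCoeff_le N A M hA _
    _ ≤ _ := by
        rw [← Finset.sum_mul, mul_comm]
        gcongr
        exact sum_abs_coeff_cosPoly_le S hS _

/-- The coefficients of a cosine polynomial with few zeros are almost periodic with few
exceptions. -/
lemma ncard_symmCoeff_ne_shift_le (N : ℕ) (A : ℕ → ℤ) (M : ℕ) (hA : ∀ n ≤ N, |A n| ≤ M)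
    (q : ℝ[X]) (hq0 : q ≠ 0)
    (hq : ∀ θ, q.eval (Real.cos θ) = ∑ n ∈ Finset.range (N + 1), (A n : ℝ) * Real.cos (n * θ))
    {Z T₀ D K : ℕ}
    (hZ : {θ : ℝ | θ ∈ Set.Icc 0 (2 * Real.pi) ∧ q.eval (Real.cos θ) = 0}.ncard ≤ Z)
    (hT₀ : (8 * M + 1) ^ (2 * Z) ≤ T₀) (hD : D = 4 * M * T₀.factorial + T₀)
    (hK : 36 * (4 * M * 4 ^ Z) ^ 2 * (2 * (D + 2 * Z) + 1) ^ 4 < K) :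
    {n | symmCoeff N A n ≠ symmCoeff N A (n - T₀.factorial)}.Finite ∧
      {n | symmCoeff N A n ≠ symmCoeff N A (n - T₀.factorial)}.ncard ≤ (D + 1) * 64 ^ K := by
  obtain ⟨S, hS, hsign⟩ := exists_sign_correction q hq0
  have hk : S.card ≤ Z := (card_le_ncard_zeros q hq0 S hS).trans hZ
  have hS1 : ∀ r ∈ S, |r| ≤ 1 := fun r hr => abs_le.2 ⟨(hS r hr).2.1.le, (hS r hr).2.2.le⟩
  refine ncard_ne_shift_le (symmCoeff N A) (finite_support_symmCoeff N A) (4 * M) (2 * S.card) T₀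
    (fun m n => ?_) ?_ (cosPoly S).coeff (coeff_zero_cosPoly S)
    (mean_norm_cosPoly_mul_le N A M hA q hq S hS1 hsign) hD ?_
  · refine (abs_sub _ _).trans ?_
    have := abs_symmCoeff_le N A M hA m
    have := abs_symmCoeff_le N A M hA n
    push_cast; linarith
  · refine le_trans ?_ hT₀
    rw [show 2 * (4 * M) + 1 = 8 * M + 1 by ring]
    exact Nat.pow_le_pow_right (by lia) (by lia)
  · have h1 : (36 * (4 * M * 4 ^ Z) ^ 2 * (2 * (D + 2 * Z) + 1) ^ 4 : ℝ) < K := by exact_mod_cast hK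
    refine lt_of_le_of_lt ?_ h1
    have h2 : (S.card : ℝ) ≤ Z := by exact_mod_cast hk
    have h3 : (4 : ℝ) ^ S.card ≤ 4 ^ Z := pow_le_pow_right₀ (by norm_num) hk
    push_cast
    calc _ = 36 * (4 * M * (4 : ℝ) ^ S.card) ^ 2 * (2 * (D + 2 * S.card) + 1) ^ 4 := by ring
      _ ≤ _ := by gcongr

end

/-- Multiplying by a Fejér kernel turns almost periodic coefficients into coefficients with few
jumps. -/
lemma exists_smoothing (a : ℤ → ℤ) (hfin : a.support.Finite) (W Q L : ℕ) (ha : ∀ n, |a n| ≤ Q)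
    (hY : {n | a n ≠ a (n - W)}.Finite) (hL : {n | a n ≠ a (n - W)}.ncard ≤ L) :
    ∃ b : ℤ → ℤ, b.support.Finite ∧ (∀ n, |b n| ≤ W ^ 2 * Q) ∧ {n | b n ≠ b (n - 1)}.Finite ∧
      {n | b n ≠ b (n - 1)}.ncard ≤ W * L ∧ ∀ θ, charSum (fun n => (b n : ℂ)) θ =
        ((‖∑ i ∈ Finset.range W, character i θ‖ ^ 2 : ℝ) : ℂ) *
          charSum (fun n => (a n : ℂ)) θ := by
  set P := Finset.range W ×ˢ Finset.range W with hP
  have hafin : (fun n => (a n : ℂ)).support.Finite := hfin.subset fun n hn => by simpa using hn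
  have hb : ∀ n, ∑ p ∈ P, a (n - ((p.1 : ℤ) - p.2)) =
      ∑ j ∈ Finset.range W, ∑ i ∈ Finset.range W, a (n - ((i : ℤ) - j)) := fun n => by
    rw [hP, Finset.sum_product_right]
  have hjump : ∀ n, ∑ p ∈ P, a (n - ((p.1 : ℤ) - p.2)) - ∑ p ∈ P, a (n - 1 - ((p.1 : ℤ) - p.2)) =
      ∑ j ∈ Finset.range W, (a (n + j) - a (n + j - W)) := fun n => by
    rw [hb, hb, ← Finset.sum_sub_distrib]
    refine Finset.sum_congr rfl fun j _ => ?_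
    rw [← Finset.sum_sub_distrib]
    have := Finset.sum_range_sub' (fun i : ℕ => a (n + j - i)) W
    simp only [Nat.cast_zero, sub_zero] at this
    rw [← this]
    refine Finset.sum_congr rfl fun i _ => ?_
    push_cast
    congr 2 <;> ring
  have hsub : {n | ∑ p ∈ P, a (n - ((p.1 : ℤ) - p.2)) ≠
      ∑ p ∈ P, a (n - 1 - ((p.1 : ℤ) - p.2))} ⊆
      ↑((Finset.range W ×ˢ hY.toFinset).image fun p => p.2 - (p.1 : ℤ)) := fun n hn => by
    have hne : ∑ j ∈ Finset.range W, (a (n + j) - a (n + j - W)) ≠ 0 := by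
      rw [← hjump]; exact sub_ne_zero.2 hn
    obtain ⟨j, hj, hne⟩ := Finset.exists_ne_zero_of_sum_ne_zero hne
    refine Finset.mem_coe.2 (Finset.mem_image.2 ⟨(j, n + j), ?_, by simp⟩)
    simpa [Finset.mem_product] using ⟨Finset.mem_range.1 hj, sub_ne_zero.1 hne⟩
  refine ⟨fun n => ∑ p ∈ P, a (n - ((p.1 : ℤ) - p.2)), ?_, fun n => ?_,
    (Finset.finite_toSet _).subset hsub, ?_, fun θ => ?_⟩
  · simpa using finite_support_convolution P (fun _ => (1 : ℤ)) (fun p => (p.1 : ℤ) - p.2) hfin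
  · refine (Finset.abs_sum_le_sum_abs _ _).trans ((Finset.sum_le_card_nsmul _ _ _
      fun p _ => ha _).trans_eq ?_)
    simp [hP, sq]
  · refine (Set.ncard_le_ncard hsub (Finset.finite_toSet _)).trans ?_
    rw [Set.ncard_coe_finset]
    refine Finset.card_image_le.trans ?_
    rw [Finset.card_product, Finset.card_range, ← Set.ncard_eq_toFinset_card _ hY]
    gcongr
  · have h := sum_character_mul_charSum P (fun _ => 1) (fun p => (p.1 : ℤ) - p.2) hafin θ
    simp only [one_mul] at h
    push_cast
    rw [← h]
    congr 1
    rw [← Complex.ofReal_pow, ← Complex.normSq_eq_norm_sq, ← Complex.mul_conj, map_sum,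
      Finset.sum_mul_sum, hP, Finset.sum_product]
    refine Finset.sum_congr rfl fun i _ => Finset.sum_congr rfl fun j _ => ?_
    rw [← character_neg, ← character_add, sub_eq_add_neg]

/-- The tent function of height `1` supported on `[-r, r]`, for nonnegative arguments. -/
noncomputable def tent (r θ : ℝ) : ℝ := max 0 (1 - θ / r)

@[fun_prop]
lemma continuous_tent (r : ℝ) : Continuous (tent r) := by unfold tent; fun_prop

/-- The Fourier coefficients of `tent r` extended to an even function. -/
noncomputable def tentCoeff (r : ℝ) (m : ℤ) : ℝ :=
  Real.pi⁻¹ * ∫ θ in (0 : ℝ)..1, tent r θ * Real.cos (m * θ)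

lemma integral_tent_mul {r : ℝ} (hr : 0 < r) (hr1 : r ≤ 1) (g : ℝ → ℝ) (hg : Continuous g) :
    ∫ θ in (0 : ℝ)..1, tent r θ * g θ = ∫ θ in (0 : ℝ)..r, (1 - θ / r) * g θ := by
  have hc : Continuous fun θ => tent r θ * g θ := by fun_prop
  have h1 : ∫ θ in r..1, tent r θ * g θ = 0 := by
    rw [intervalIntegral.integral_congr (g := fun _ => 0), intervalIntegral.integral_zero]
    intro θ hθ
    rw [Set.uIcc_of_le hr1] at hθ
    have : 1 ≤ θ / r := (one_le_div hr).2 hθ.1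
    simp [tent, this]
  rw [← intervalIntegral.integral_add_adjacent_intervals (hc.intervalIntegrable 0 r)
    (hc.intervalIntegrable r 1), h1, add_zero]
  refine intervalIntegral.integral_congr fun θ hθ => ?_
  rw [Set.uIcc_of_le hr.le] at hθ
  have : θ / r ≤ 1 := (div_le_one hr).2 hθ.2
  simp only [tent]
  rw [max_eq_right (by linarith)]

lemma tentCoeff_of_ne_zero {r : ℝ} (hr : 0 < r) (hr1 : r ≤ 1) {m : ℤ} (hm : m ≠ 0) :
    tentCoeff r m = (1 - Real.cos (m * r)) / (Real.pi * m ^ 2 * r) := by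
  have hm' : (m : ℝ) ≠ 0 := by exact_mod_cast hm
  rw [tentCoeff, integral_tent_mul hr hr1 _ (by fun_prop),
    intervalIntegral.integral_eq_sub_of_hasDerivAt
      (f := fun θ => (1 - θ / r) * (Real.sin (m * θ) / m) - Real.cos (m * θ) / (m ^ 2 * r))
      (fun θ _ => ?_) (Continuous.intervalIntegrable (by fun_prop) _ _)]
  · simp only [mul_zero, Real.cos_zero, Real.sin_zero, div_self hr.ne']
    field_simp
    ring
  · have h0 : HasDerivAt (fun θ : ℝ => m * θ) m θ := by
      simpa using (hasDerivAt_id θ).const_mul (m : ℝ)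
    have h1 : HasDerivAt (fun θ : ℝ => 1 - θ / r) (-(1 / r)) θ :=
      ((hasDerivAt_id θ).div_const r).const_sub 1
    have h2 := (h1.mul (h0.sin.div_const m)).sub (h0.cos.div_const (m ^ 2 * r))
    refine h2.congr_deriv ?_
    field_simp
    ring

lemma tentCoeff_zero {r : ℝ} (hr : 0 < r) (hr1 : r ≤ 1) : tentCoeff r 0 = r / (2 * Real.pi) := by
  rw [tentCoeff, integral_tent_mul hr hr1 _ (by fun_prop)]
  simp only [Int.cast_zero, zero_mul, Real.cos_zero, mul_one]
  rw [intervalIntegral.integral_sub (by simp) (Continuous.intervalIntegrable (by fun_prop) _ _),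
    intervalIntegral.integral_div]
  simp
  field_simp
  ring

lemma tentCoeff_nonneg {r : ℝ} (hr : 0 < r) (hr1 : r ≤ 1) (m : ℤ) : 0 ≤ tentCoeff r m := by
  have := Real.pi_pos
  rcases eq_or_ne m 0 with rfl | hm
  · rw [tentCoeff_zero hr hr1]; positivity
  · rw [tentCoeff_of_ne_zero hr hr1 hm]
    exact div_nonneg (by linarith [Real.cos_le_one (m * r)]) (by positivity)

lemma tentCoeff_le {r : ℝ} (hr : 0 < r) (hr1 : r ≤ 1) (m : ℤ) : tentCoeff r m ≤ r / 6 := by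
  have hpi := Real.pi_gt_three
  have h0 : r / (2 * Real.pi) ≤ r / 6 := by gcongr; linarith
  refine le_trans ?_ h0
  rcases eq_or_ne m 0 with rfl | hm
  · rw [tentCoeff_zero hr hr1]
  · have hm' : (m : ℝ) ≠ 0 := by exact_mod_cast hm
    rw [tentCoeff_of_ne_zero hr hr1 hm, div_le_div_iff₀ (by positivity) (by positivity)]
    have := Real.one_sub_sq_div_two_le_cos (x := m * r)
    nlinarith [Real.pi_pos]

lemma tentCoeff_le_inv_sq {r : ℝ} (hr : 0 < r) (hr1 : r ≤ 1) {m : ℤ} (hm : m ≠ 0) :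
    tentCoeff r m ≤ 1 / r * (1 / (m : ℝ) ^ 2) := by
  have hpi := Real.pi_gt_three
  have hm' : (m : ℝ) ≠ 0 := by exact_mod_cast hm
  rw [tentCoeff_of_ne_zero hr hr1 hm, div_mul_div_comm,
    div_le_div_iff₀ (by positivity) (by positivity)]
  have := Real.neg_one_le_cos (m * r)
  have h : 0 < (m : ℝ) ^ 2 * r := by positivity
  nlinarith

lemma hasSum_one_sub_cos_div_sq {r : ℝ} (hr : 0 ≤ r) (hr1 : r ≤ 2 * Real.pi) :
    HasSum (fun n : ℕ => (1 - Real.cos (n * r)) / (n : ℝ) ^ 2)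
      (Real.pi * r / 2 - r ^ 2 / 4) := by
  have hpi := Real.pi_pos
  have h := hasSum_one_div_nat_pow_mul_cos (k := 1) one_ne_zero (x := r / (2 * Real.pi))
    ⟨by positivity, (div_le_one (by positivity)).2 hr1⟩
  have hb : Polynomial.eval (r / (2 * Real.pi)) (Polynomial.map (algebraMap ℚ ℝ)
      (Polynomial.bernoulli (2 * 1))) = (r / (2 * Real.pi)) ^ 2 - r / (2 * Real.pi) + 6⁻¹ :=
    bernoulliFun_two _
  rw [hb] at h
  have h2 := hasSum_zeta_two.sub h
  have hval : Real.pi ^ 2 / 6 - (-1) ^ (1 + 1) * (2 * Real.pi) ^ (2 * 1) / 2 /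
      ((2 * 1).factorial : ℝ) * ((r / (2 * Real.pi)) ^ 2 - r / (2 * Real.pi) + 6⁻¹) =
      Real.pi * r / 2 - r ^ 2 / 4 := by
    norm_num [Nat.factorial]
    field_simp
    ring
  rw [hval] at h2
  refine h2.congr_fun fun n => ?_
  rw [show 2 * Real.pi * n * (r / (2 * Real.pi)) = n * r by field_simp]
  ring

lemma hasSum_tentCoeff {r : ℝ} (hr : 0 < r) (hr1 : r ≤ 1) : HasSum (tentCoeff r) 1 := by
  have hpi := Real.pi_gt_three
  have h := ((hasSum_one_sub_cos_div_sq hr.le (by linarith)).mul_left (1 / (Real.pi * r))).add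
    (hasSum_ite_eq (0 : ℕ) (r / (2 * Real.pi)))
  have hnat : ∀ n : ℕ, tentCoeff r n = 1 / (Real.pi * r) * ((1 - Real.cos (n * r)) / (n : ℝ) ^ 2) +
      if n = 0 then r / (2 * Real.pi) else 0 := fun n => by
    rcases eq_or_ne n 0 with rfl | hn
    · simp [tentCoeff_zero hr hr1]
    · rw [tentCoeff_of_ne_zero hr hr1 (by exact_mod_cast hn), if_neg hn, add_zero, div_mul_div_comm]
      push_cast
      congr 1 <;> ring
  have hneg : ∀ n : ℤ, tentCoeff r (-n) = tentCoeff r n := fun n => by simp [tentCoeff]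
  have h1 := h.congr_fun hnat
  have h2 := HasSum.of_nat_of_neg h1 (by simpa only [hneg] using h1)
  rw [tentCoeff_zero hr hr1] at h2
  refine h2.summable.hasSum_iff.2 (h2.tsum_eq.trans ?_)
  field_simp
  ring

lemma tsum_inv_sq_tail_le {A : ℕ} (hA : 0 < A) :
    Summable (fun m : ℤ => if |m| ≤ A then 0 else 1 / (m : ℝ) ^ 2) ∧
    ∑' m : ℤ, (if |m| ≤ A then 0 else 1 / (m : ℝ) ^ 2) ≤ 2 / (A : ℝ) := by
  set f : ℤ → ℝ := fun m => if |m| ≤ A then 0 else 1 / (m : ℝ) ^ 2 with hf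
  have hf0 : ∀ m, 0 ≤ f m := fun m => by simp only [hf]; split_ifs <;> positivity
  have hneg : ∀ m, f (-m) = f m := fun m => by simp [hf]
  have hnat : ∀ n : ℕ, ∑ i ∈ Finset.range n, f i ≤ 1 / A := fun n => by
    calc ∑ i ∈ Finset.range n, f i
        = ∑ i ∈ (Finset.range n).filter (A < ·), ((i : ℝ) ^ 2)⁻¹ := by
          rw [Finset.sum_filter]
          refine Finset.sum_congr rfl fun i _ => ?_
          rcases lt_or_ge A i with h | h <;> simp [hf, h]
      _ ≤ ∑ i ∈ Finset.Ioc A (A + n), ((i : ℝ) ^ 2)⁻¹ :=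
          Finset.sum_le_sum_of_subset_of_nonneg (fun i hi => by
            simp only [Finset.mem_filter, Finset.mem_range, Finset.mem_Ioc] at hi ⊢; lia)
            fun i _ _ => by positivity
      _ ≤ _ := by
          refine (sum_Ioc_inv_sq_le_sub hA.ne' (by lia)).trans ?_
          rw [one_div]
          exact sub_le_self _ (by positivity)
  have hs : ∀ n : ℕ, ∑ i ∈ Finset.range n, f (-((i : ℤ) + 1)) ≤ 1 / A := fun n => by
    refine le_trans ?_ (hnat (n + 1))
    rw [Finset.sum_range_succ']
    refine le_add_of_le_of_nonneg (Finset.sum_le_sum fun i _ => ?_) (hf0 _)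
    rw [hneg, Nat.cast_add_one]
  have s1 := summable_of_sum_range_le (fun n => hf0 _) hnat
  have s2 := summable_of_sum_range_le (fun n => hf0 _) hs
  refine ⟨Summable.of_nat_of_neg_add_one s1 s2, ?_⟩
  have htsum : ∑' m, f m ≤ 1 / (A : ℝ) + 1 / A := by
    rw [tsum_of_nat_of_neg_add_one s1 s2]
    exact add_le_add (Real.tsum_le_of_sum_range_le (fun n => hf0 _) hnat)
      (Real.tsum_le_of_sum_range_le (fun n => hf0 _) hs)
  exact htsum.trans_eq (by ring)

/-- The Fourier coefficients of the de la Vallée Poussin type kernel which is `1` on `[-r, r]` and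
vanishes outside `[-2r, 2r]`. -/
noncomputable def plateauCoeff (r : ℝ) (m : ℤ) : ℝ := 2 * tentCoeff (2 * r) m - tentCoeff r m

section plateau

variable {r : ℝ} (hr : 0 < r) (hr1 : 2 * r ≤ 1)
include hr hr1

lemma hasSum_plateauCoeff : HasSum (plateauCoeff r) 1 := by
  have h := ((hasSum_tentCoeff (r := 2 * r) (by linarith) hr1).mul_left 2).sub
    (hasSum_tentCoeff hr (by linarith))
  norm_num at h
  exact h

lemma abs_plateauCoeff_le_add (m : ℤ) :
    |plateauCoeff r m| ≤ 2 * tentCoeff (2 * r) m + tentCoeff r m := by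
  have h1 := tentCoeff_nonneg (r := 2 * r) (by linarith) hr1 m
  have h2 := tentCoeff_nonneg hr (by linarith) m
  rw [plateauCoeff, abs_le]
  constructor <;> linarith

lemma summable_abs_plateauCoeff :
    Summable (fun m => |plateauCoeff r m|) ∧ ∑' m, |plateauCoeff r m| ≤ 3 := by
  have h := ((hasSum_tentCoeff (r := 2 * r) (by linarith) hr1).mul_left 2).add
    (hasSum_tentCoeff hr (by linarith))
  have hs := h.summable.of_nonneg_of_le (fun _ => abs_nonneg _) (abs_plateauCoeff_le_add hr hr1)
  refine ⟨hs, (hs.tsum_le_tsum (abs_plateauCoeff_le_add hr hr1) h.summable).trans ?_⟩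
  rw [h.tsum_eq]; norm_num

lemma abs_plateauCoeff_le (m : ℤ) : |plateauCoeff r m| ≤ r := by
  have h1 := tentCoeff_le (r := 2 * r) (by linarith) hr1 m
  have h2 := tentCoeff_le hr (by linarith) m
  linarith [abs_plateauCoeff_le_add hr hr1 m]

lemma abs_plateauCoeff_le_inv_sq {m : ℤ} (hm : m ≠ 0) :
    |plateauCoeff r m| ≤ 2 / r * (1 / (m : ℝ) ^ 2) := by
  have h1 := tentCoeff_le_inv_sq (r := 2 * r) (by linarith) hr1 hm
  have h2 := tentCoeff_le_inv_sq hr (by linarith) hm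
  refine (abs_plateauCoeff_le_add hr hr1 m).trans ((add_le_add (mul_le_mul_of_nonneg_left h1
    zero_le_two) h2).trans_eq ?_)
  field_simp
  ring

end plateau

/-- The sequence `b` averaged against the kernel `plateauCoeff r`. -/
noncomputable def plateauMean (b : ℤ → ℤ) (r : ℝ) (l : ℤ) : ℝ := ∑' m, b (m + l) * plateauCoeff r m

section plateauMean

variable {r : ℝ} (hr : 0 < r) (hr1 : 2 * r ≤ 1) {b : ℤ → ℤ} {Q : ℕ} (hb : ∀ n, |b n| ≤ Q)
include hr hr1 hb

lemma summable_mul_plateauCoeff (l : ℤ) : Summable fun m => b (m + l) * plateauCoeff r m := by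
  refine ((summable_abs_plateauCoeff hr hr1).1.mul_left (Q : ℝ)).of_norm_bounded fun m => ?_
  rw [Real.norm_eq_abs, abs_mul]
  gcongr
  exact_mod_cast hb _

lemma abs_plateauMean_le (l : ℤ) : |plateauMean b r l| ≤ 3 * Q := by
  obtain ⟨hs, h3⟩ := summable_abs_plateauCoeff hr hr1
  rw [← Real.norm_eq_abs, plateauMean]
  refine (tsum_of_norm_bounded (hs.mul_left (Q : ℝ)).hasSum fun m => ?_).trans ?_
  · rw [Real.norm_eq_abs, abs_mul]
    gcongr
    exact_mod_cast hb _
  · rw [tsum_mul_left, mul_comm]; gcongr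

lemma abs_plateauMean_sub_le {A : ℕ} (hA : 0 < A) (l : ℤ)
    (hconst : ∀ m : ℤ, |m| ≤ A → b (m + l) = b l) :
    |plateauMean b r l - b l| ≤ 8 * Q / (r * A) := by
  obtain ⟨hs, h2⟩ := tsum_inv_sq_tail_le hA
  have h := (summable_mul_plateauCoeff hr hr1 hb l).hasSum.sub
    ((hasSum_plateauCoeff hr hr1).mul_left (b l : ℝ))
  rw [mul_one] at h
  rw [plateauMean, ← h.tsum_eq, ← Real.norm_eq_abs]
  refine (tsum_of_norm_bounded (hs.mul_left (2 * Q * (2 / r))).hasSum fun m => ?_).trans ?_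
  · rw [Real.norm_eq_abs, ← sub_mul, abs_mul]
    split_ifs with hm
    · simp [hconst m hm]
    · have hm0 : m ≠ 0 := by rintro rfl; simp at hm
      have h3 : |(b (m + l) : ℝ) - b l| ≤ 2 * Q := by
        have := abs_sub (b (m + l)) (b l)
        have := hb (m + l)
        have := hb l
        exact_mod_cast (by linarith : |b (m + l) - b l| ≤ 2 * Q)
      rw [mul_assoc (2 * (Q : ℝ))]
      gcongr
      exact abs_plateauCoeff_le_inv_sq hr hr1 hm0
  · rw [tsum_mul_left]
    refine (mul_le_mul_of_nonneg_left h2 (by positivity)).trans_eq ?_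
    field_simp
    ring

lemma abs_plateauMean_sub_plateauMean_le {L : ℕ} (hfin : {n | b n ≠ b (n - 1)}.Finite)
    (hL : {n | b n ≠ b (n - 1)}.ncard ≤ L) (l : ℤ) :
    |plateauMean b r l - plateauMean b r (l - 1)| ≤ 2 * Q * L * r := by
  rw [plateauMean, plateauMean, ← (summable_mul_plateauCoeff hr hr1 hb l).tsum_sub
    (summable_mul_plateauCoeff hr hr1 hb (l - 1)),
    tsum_eq_sum (s := hfin.toFinset.image (· - l)) fun m hm => ?_]
  · calc _ ≤ ∑ m ∈ hfin.toFinset.image (· - l), 2 * Q * r := by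
          refine (Finset.abs_sum_le_sum_abs _ _).trans (Finset.sum_le_sum fun m _ => ?_)
          have h3 : |(b (m + l) : ℝ) - b (m + (l - 1))| ≤ 2 * Q := by
            have := abs_sub (b (m + l)) (b (m + (l - 1)))
            have := hb (m + l)
            have := hb (m + (l - 1))
            exact_mod_cast (by linarith : |b (m + l) - b (m + (l - 1))| ≤ 2 * Q)
          rw [← sub_mul, abs_mul]
          gcongr
          exact abs_plateauCoeff_le hr hr1 m
      _ ≤ L * (2 * Q * r) := by
          rw [Finset.sum_const, nsmul_eq_mul]
          gcongr
          refine Finset.card_image_le.trans ?_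
          rwa [← Set.ncard_eq_toFinset_card _ hfin]
      _ = _ := by ring
  · have : b (m + l) = b (m + (l - 1)) := by
      by_contra hne
      refine hm (Finset.mem_image.2 ⟨m + l, ?_, by simp⟩)
      simpa [add_sub_assoc] using hne
    rw [this, sub_self]

end plateauMean

lemma plateauMean_eq_integral (b : ℤ → ℤ) (hb : b.support.Finite) (F : ℝ → ℝ)
    (hF : ∀ θ, charSum (fun n => (b n : ℂ)) θ = F θ) (r : ℝ) (l : ℤ) :
    plateauMean b r l = Real.pi⁻¹ * ∫ θ in (0 : ℝ)..1,
      F θ * (2 * tent (2 * r) θ - tent r θ) * Real.cos (l * θ) := by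
  set T := hb.toFinset with hT
  have h0 : ∀ n ∉ T, b n = 0 := by simp [hT]
  have hcos : ∀ θ, F θ * Real.cos (l * θ) = ∑ n ∈ T, b n * Real.cos ((n - l : ℤ) * θ) := fun θ => by
    have hre : ∀ m : ℤ, (character m θ).re = Real.cos (m * θ) := fun m => by
      have := Complex.exp_ofReal_mul_I_re (m * θ)
      push_cast at this ⊢
      exact this
    have h := congrArg (fun z => (z * character (-l) θ).re) (hF θ)
    rw [charSum_eq_sum (T := T) (fun n hn => by simp [h0 n hn]), Finset.sum_mul,
      Complex.re_sum, Complex.re_ofReal_mul, hre] at h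
    rw [show F θ * Real.cos (l * θ) = F θ * Real.cos (((-l : ℤ) : ℝ) * θ) by simp, ← h]
    refine Finset.sum_congr rfl fun n _ => ?_
    rw [mul_assoc, ← character_add, ← sub_eq_add_neg, ← hre, ← Complex.re_ofReal_mul,
      Complex.ofReal_intCast]
  have hterm : ∀ θ, F θ * (2 * tent (2 * r) θ - tent r θ) * Real.cos (l * θ) =
      ∑ n ∈ T, b n * (2 * (tent (2 * r) θ * Real.cos ((n - l : ℤ) * θ)) -
        tent r θ * Real.cos ((n - l : ℤ) * θ)) := fun θ => by
    rw [mul_right_comm, hcos, Finset.sum_mul]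
    exact Finset.sum_congr rfl fun n _ => by ring
  rw [plateauMean, ← (Equiv.subRight l).tsum_eq, tsum_eq_sum (s := T) fun n hn => by simp [h0 n hn]]
  simp_rw [hterm]
  rw [intervalIntegral.integral_finsetSum fun n _ =>
    Continuous.intervalIntegrable (by fun_prop) _ _,
    Finset.mul_sum]
  refine Finset.sum_congr rfl fun n _ => ?_
  rw [intervalIntegral.integral_const_mul, intervalIntegral.integral_sub
    (Continuous.intervalIntegrable (by fun_prop) _ _)
    (Continuous.intervalIntegrable (by fun_prop) _ _), intervalIntegral.integral_const_mul]
  simp only [Equiv.subRight_apply, sub_add_cancel, plateauCoeff, tentCoeff]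
  ring

/-- If averages of `b` at two very different scales agree, then `b` vanishes away from its jumps,
so that its sum is small. -/
lemma abs_tsum_mul_le_one {b : ℤ → ℤ} (hbfin : b.support.Finite) {Q L : ℕ} (hQ : 1 ≤ Q)
    (hL1 : 1 ≤ L) (hb : ∀ n, |b n| ≤ Q) (hfin : {n | b n ≠ b (n - 1)}.Finite)
    (hL : {n | b n ≠ b (n - 1)}.ncard ≤ L) {r r' : ℝ} (hr : 0 < r) (hr' : 2 * r' ≤ 1)
    (hrr' : r * (2000 * L ^ 2 * Q ^ 2) ≤ r')
    (hdiff : ∀ l, |plateauMean b r' l - plateauMean b r l| ≤ 1 / 8) :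
    |∑' n, (b n : ℝ)| * r ≤ 1 := by
  have hQ' : (1 : ℝ) ≤ Q := by exact_mod_cast hQ
  have hL' : (1 : ℝ) ≤ L := by exact_mod_cast hL1
  have hr'0 : 0 < r' := lt_of_lt_of_le (by positivity) hrr'
  have hr1 : 2 * r ≤ 1 := by
    have : (1 : ℝ) ≤ 2000 * L ^ 2 * Q ^ 2 := by
      nlinarith [one_le_pow₀ hQ' (n := 2), one_le_pow₀ hL' (n := 2)]
    nlinarith
  set x : ℝ := 64 * Q / r' with hx
  have hx1 : 1 ≤ x := by rw [hx, one_le_div hr'0]; linarith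
  set A : ℕ := ⌈x⌉₊ with hA
  have hAx : x ≤ A := Nat.le_ceil x
  have hA2 : (A : ℝ) ≤ 128 * Q / r' := by
    have h1 := (Nat.ceil_lt_add_one (by linarith : 0 ≤ x)).le
    have h2 : 128 * Q / r' = 2 * x := by rw [hx]; ring
    rw [h2]; linarith
  have hA0 : 0 < A := by
    have : (0 : ℝ) < A := by linarith
    exact_mod_cast this
  set Bad := hfin.toFinset.biUnion fun p => Finset.Ico (p - A) (p + A) with hBad
  have hcard : Bad.card ≤ L * (2 * A) := by
    refine (Finset.card_biUnion_le_card_mul _ _ (2 * A) fun p _ => ?_).trans ?_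
    · rw [Int.card_Ico]; lia
    · rw [← Set.ncard_eq_toFinset_card _ hfin]; gcongr
  have hconst : ∀ n ∉ Bad, ∀ m : ℤ, |m| ≤ A → b (m + n) = b n := fun n hn => by
    have hstep : ∀ p, n - A < p → p ≤ n + A → b p = b (p - 1) := fun p h1 h2 => by
      by_contra hne
      refine hn (Finset.mem_biUnion.2 ⟨p, by simpa using hne, Finset.mem_Ico.2 ⟨?_, ?_⟩⟩) <;> lia
    have hup : ∀ k : ℕ, k ≤ A → b (n + k) = b n := fun k => by
      induction k with
      | zero => simp
      | succ k ih =>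
        intro hk
        rw [hstep _ (by lia) (by lia), ← ih (by lia)]
        congr 1; push_cast; ring
    have hdown : ∀ k : ℕ, k ≤ A → b (n - k) = b n := fun k => by
      induction k with
      | zero => simp
      | succ k ih =>
        intro hk
        rw [← ih (by lia), hstep (n - k) (by lia) (by lia)]
        congr 1; push_cast; ring
    intro m hm
    obtain ⟨k, rfl | rfl⟩ := m.eq_nat_or_neg
    · rw [add_comm]; exact hup k (by simpa using hm)
    · rw [neg_add_eq_sub]; exact hdown k (by simpa using hm)
  have hgood : ∀ n ∉ Bad, |plateauMean b r n - b n| ≤ 1 / 4 := fun n hn => by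
    have h1 := abs_plateauMean_sub_le hr'0 hr' hb hA0 n (hconst n hn)
    have h2 : 8 * Q / (r' * A) ≤ 1 / 8 := by
      rw [hx, div_le_iff₀ hr'0] at hAx
      rw [div_le_iff₀ (by positivity)]
      linarith
    have h3 := hdiff n
    rw [abs_le] at *
    constructor <;> linarith
  have hlip : ∀ (n : ℤ) (k : ℕ), |plateauMean b r n - plateauMean b r (n - k)| ≤
      k * (2 * Q * L * r) := fun n k => by
    induction k with
    | zero => simp
    | succ k ih =>
      have h := abs_plateauMean_sub_plateauMean_le hr hr1 hb hfin hL (n - k)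
      rw [show n - (k : ℤ) - 1 = n - (k + 1 : ℕ) by push_cast; ring] at h
      refine (abs_sub_le _ (plateauMean b r (n - k)) _).trans ((add_le_add ih h).trans_eq ?_)
      push_cast; ring
  have hsmall : ((L * (2 * A) + 1 : ℕ) : ℝ) * (2 * Q * L * r) < 1 / 2 := by
    have hA1 : (1 : ℝ) ≤ A := by exact_mod_cast hA0
    have h1 : ((L * (2 * A) + 1 : ℕ) : ℝ) ≤ 3 * L * A := by push_cast; nlinarith
    have h2 : 2 * Q * L * r * (1000 * L * Q) ≤ r' := by linarith
    calc _ ≤ 3 * L * (128 * Q / r') * (2 * Q * L * r) := by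
          refine (mul_le_mul_of_nonneg_right h1 (by positivity)).trans ?_
          gcongr
      _ = 2 * Q * L * r * (1000 * L * Q) * (384 / 1000) / r' := by field_simp; ring
      _ ≤ r' * (384 / 1000) / r' := by gcongr
      _ < 1 / 2 := by rw [mul_div_cancel_left₀ _ hr'0.ne']; norm_num
  have hzero : ∀ n ∉ Bad, b n = 0 := by
    by_contra! hcon
    set S := hbfin.toFinset.filter (· ∉ Bad) with hS
    have hSmem : ∀ n, n ∈ S ↔ b n ≠ 0 ∧ n ∉ Bad := fun n => by simp [hS]
    have hSne : S.Nonempty := by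
      obtain ⟨n, h1, h2⟩ := hcon
      exact ⟨n, (hSmem n).2 ⟨h2, h1⟩⟩
    set n := S.min' hSne with hn
    obtain ⟨hn1, hn2⟩ := (hSmem n).1 (S.min'_mem hSne)
    obtain ⟨m, hm, hmB⟩ : ∃ m ∈ Finset.Ico (n - (L * (2 * A) + 1 : ℕ)) n, m ∉ Bad := by
      refine Finset.exists_mem_notMem_of_card_lt_card ?_
      rw [Int.card_Ico]; lia
    rw [Finset.mem_Ico] at hm
    have hbm : b m = 0 := by
      by_contra hne
      exact absurd (S.min'_le m ((hSmem m).2 ⟨hne, hmB⟩)) (by lia)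
    obtain ⟨k, hk⟩ : ∃ k : ℕ, m = n - k := ⟨(n - m).toNat, by lia⟩
    have h1 := hgood n hn2
    have h2 := hgood m hmB
    have h3 := hlip n k
    have h4 : (k : ℝ) ≤ ((L * (2 * A) + 1 : ℕ) : ℝ) := by
      rw [Nat.cast_le]; lia
    have h5 : (k : ℝ) * (2 * Q * L * r) < 1 / 2 :=
      lt_of_le_of_lt (mul_le_mul_of_nonneg_right h4 (by positivity)) hsmall
    rw [← hk] at h3
    rw [hbm] at h2
    have h6 : |(b n : ℝ)| < 1 := by
      push_cast at h2
      rw [abs_le] at h1 h2 h3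
      rw [abs_lt]
      constructor <;> linarith
    have h7 : |b n| < 1 := by exact_mod_cast h6
    exact hn1 (Int.abs_lt_one_iff.1 h7)
  rw [tsum_eq_sum (s := Bad) fun n hn => by simp [hzero n hn]]
  have hsum : |∑ n ∈ Bad, (b n : ℝ)| ≤ L * (2 * A) * Q := by
    calc _ ≤ ∑ n ∈ Bad, (Q : ℝ) := (Finset.abs_sum_le_sum_abs _ _).trans
          (Finset.sum_le_sum fun n _ => by exact_mod_cast hb n)
      _ ≤ _ := by
          rw [Finset.sum_const, nsmul_eq_mul]
          gcongr
          exact_mod_cast hcard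
  calc _ ≤ L * (2 * (128 * Q / r')) * Q * r := by
        refine (mul_le_mul_of_nonneg_right hsum hr.le).trans ?_
        gcongr
    _ = r * (2000 * L ^ 1 * Q ^ 2) * (256 / 2000) / r' := by field_simp; ring
    _ ≤ r * (2000 * L ^ 2 * Q ^ 2) * (256 / 2000) / r' := by gcongr; norm_num
    _ ≤ r' * (256 / 2000) / r' := by gcongr
    _ ≤ 1 := by rw [mul_div_cancel_left₀ _ hr'0.ne']; norm_num

lemma plateau_mem_Icc {r θ : ℝ} (hr : 0 < r) (hθ : 0 ≤ θ) :
    2 * tent (2 * r) θ - tent r θ ∈ Set.Icc 0 1 := by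
  have h : θ / (2 * r) = θ / r / 2 := by field_simp
  have h0 : 0 ≤ θ / r := by positivity
  simp only [tent, h, Set.mem_Icc]
  constructor <;> rcases max_cases 0 (1 - θ / r / 2) with h1 | h1 <;>
    rcases max_cases 0 (1 - θ / r) with h2 | h2 <;> linarith

lemma plateau_eq_one {r θ : ℝ} (hr : 0 < r) (hθ : θ ≤ r) : 2 * tent (2 * r) θ - tent r θ = 1 := by
  have h : θ / (2 * r) = θ / r / 2 := by field_simp
  have h0 : θ / r ≤ 1 := (div_le_one hr).2 hθ
  simp only [tent, h]
  rw [max_eq_right (by linarith), max_eq_right (by linarith)]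
  ring

lemma plateau_eq_zero {r θ : ℝ} (hr : 0 < r) (hθ : 2 * r ≤ θ) :
    2 * tent (2 * r) θ - tent r θ = 0 := by
  have h : θ / (2 * r) = θ / r / 2 := by field_simp
  have h0 : 2 ≤ θ / r := (le_div_iff₀ hr).2 hθ
  simp only [tent, h]
  rw [max_eq_left (by linarith), max_eq_left (by linarith)]
  ring

lemma abs_plateauMean_sub_plateauMean_le_of_nonneg (b : ℤ → ℤ) (hb : b.support.Finite) {F : ℝ → ℝ}
    (hFc : Continuous F) (hF : ∀ θ, charSum (fun n => (b n : ℂ)) θ = F θ) {r r' : ℝ} (hr : 0 < r)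
    (hrr' : 2 * r ≤ r') (hpos : ∀ θ ∈ Set.Icc r (2 * r'), 0 ≤ F θ) (l : ℤ) :
    |plateauMean b r' l - plateauMean b r l| ≤ plateauMean b r' 0 - plateauMean b r 0 := by
  set G : ℝ → ℝ := fun θ => F θ * ((2 * tent (2 * r') θ - tent r' θ) -
    (2 * tent (2 * r) θ - tent r θ)) with hG
  have hGc : Continuous G := by fun_prop
  have hrep : ∀ k, plateauMean b r' k - plateauMean b r k =
      Real.pi⁻¹ * ∫ θ in (0 : ℝ)..1, G θ * Real.cos (k * θ) := fun k => by
    rw [plateauMean_eq_integral b hb F hF, plateauMean_eq_integral b hb F hF, ← mul_sub,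
      ← intervalIntegral.integral_sub (Continuous.intervalIntegrable (by fun_prop) _ _)
      (Continuous.intervalIntegrable (by fun_prop) _ _)]
    congr 2; ext θ; simp only [hG]; ring
  have hG0 : ∀ θ ∈ Set.Icc (0 : ℝ) 1, 0 ≤ G θ := fun θ hθ => by
    rcases le_total θ r with h1 | h1
    · simp [hG, plateau_eq_one hr h1, plateau_eq_one (r := r') (by linarith) (by linarith : θ ≤ r')]
    rcases le_total (2 * r') θ with h2 | h2
    · simp [hG, plateau_eq_zero hr (by linarith : 2 * r ≤ θ),
        plateau_eq_zero (r := r') (by linarith) h2]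
    refine mul_nonneg (hpos θ ⟨h1, h2⟩) ?_
    have h3 := plateau_mem_Icc hr hθ.1
    have h4 := plateau_mem_Icc (r := r') (by linarith) hθ.1
    rcases le_total θ r' with h5 | h5
    · rw [plateau_eq_one (r := r') (by linarith) h5]; linarith [h3.2]
    · rw [plateau_eq_zero hr (by linarith : 2 * r ≤ θ)]; linarith [h4.1]
  rw [hrep, hrep, abs_mul, abs_of_pos (inv_pos.2 Real.pi_pos)]
  refine mul_le_mul_of_nonneg_left ?_ (inv_pos.2 Real.pi_pos).le
  refine (intervalIntegral.abs_integral_le_integral_abs zero_le_one).trans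
    (intervalIntegral.integral_mono_on zero_le_one (Continuous.intervalIntegrable (by fun_prop) _ _)
      (Continuous.intervalIntegrable (by fun_prop) _ _) fun θ hθ => ?_)
  rw [abs_mul, abs_of_nonneg (hG0 θ hθ)]
  simpa using mul_le_mul_of_nonneg_left (Real.abs_cos_le_one (l * θ)) (hG0 θ hθ)

/-- A trigonometric polynomial with few coefficient jumps and no sign change on many scales is
small at `0`. -/
lemma abs_apply_zero_mul_le_one_of_nonneg {b : ℤ → ℤ} (hbfin : b.support.Finite) {Q L : ℕ}
    (hQ : 1 ≤ Q) (hL1 : 1 ≤ L) (hb : ∀ n, |b n| ≤ Q) (hfin : {n | b n ≠ b (n - 1)}.Finite)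
    (hL : {n | b n ≠ b (n - 1)}.ncard ≤ L) {F : ℝ → ℝ} (hFc : Continuous F)
    (hF : ∀ θ, charSum (fun n => (b n : ℂ)) θ = F θ) {r₀ : ℝ} (hr₀ : 0 < r₀)
    {Λ : ℝ} (hΛ : 2000 * L ^ 2 * Q ^ 2 ≤ Λ) {J : ℕ} (hJ : 48 * Q ≤ J) (h1 : 2 * r₀ * Λ ^ J ≤ 1)
    (hpos : ∀ θ ∈ Set.Icc r₀ (2 * r₀ * Λ ^ J), 0 ≤ F θ) :
    |F 0| * r₀ ≤ 1 := by
  have hQ' : (1 : ℝ) ≤ Q := by exact_mod_cast hQ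
  have hL' : (1 : ℝ) ≤ L := by exact_mod_cast hL1
  have hΛ2 : 2 ≤ Λ := by
    nlinarith [one_le_pow₀ hQ' (n := 2), one_le_pow₀ hL' (n := 2)]
  have hscale : ∀ i ≤ J, 0 < r₀ * Λ ^ i ∧ r₀ ≤ r₀ * Λ ^ i ∧ 2 * (r₀ * Λ ^ i) ≤ 2 * r₀ * Λ ^ J :=
    fun i hi => by
      have h2 : 1 ≤ Λ ^ i := one_le_pow₀ (by linarith)
      have h3 : Λ ^ i ≤ Λ ^ J := pow_le_pow_right₀ (by linarith) hi
      refine ⟨by positivity, by nlinarith, by nlinarith⟩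
  have hF0 : F 0 = ∑' n, (b n : ℝ) := by
    have h := hF 0
    simp only [charSum, character, Complex.ofReal_zero, mul_zero, zero_mul, Complex.exp_zero,
      mul_one] at h
    have h2 : ((∑' n, (b n : ℝ) : ℝ) : ℂ) = F 0 := by rw [Complex.ofReal_tsum]; simpa using h
    exact_mod_cast h2.symm
  have hmono : ∀ i < J, ∀ l, |plateauMean b (r₀ * Λ ^ (i + 1)) l - plateauMean b (r₀ * Λ ^ i) l| ≤
      plateauMean b (r₀ * Λ ^ (i + 1)) 0 - plateauMean b (r₀ * Λ ^ i) 0 := fun i hi => by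
    obtain ⟨h2, h3, _⟩ := hscale i hi.le
    obtain ⟨_, _, h4⟩ := hscale (i + 1) hi
    refine abs_plateauMean_sub_plateauMean_le_of_nonneg b hbfin hFc hF h2 ?_
      fun θ hθ => hpos θ ⟨h3.trans hθ.1, hθ.2.trans h4⟩
    rw [pow_succ]; nlinarith
  obtain ⟨i, hi, hsmall⟩ : ∃ i ∈ Finset.range J,
      plateauMean b (r₀ * Λ ^ (i + 1)) 0 - plateauMean b (r₀ * Λ ^ i) 0 ≤ 1 / 8 := by
    by_contra! hcon
    have hne : (Finset.range J).Nonempty := Finset.nonempty_range_iff.2 (by lia)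
    have h2 := Finset.sum_lt_sum_of_nonempty hne hcon
    rw [Finset.sum_range_sub fun i => plateauMean b (r₀ * Λ ^ i) 0, Finset.sum_const,
      Finset.card_range, nsmul_eq_mul] at h2
    have h3 := abs_plateauMean_le (hscale J le_rfl).1 ((hscale J le_rfl).2.2.trans h1) hb 0
    have h4 := abs_plateauMean_le (hscale 0 J.zero_le).1 ((hscale 0 J.zero_le).2.2.trans h1) hb 0
    have h5 : (48 * Q : ℝ) ≤ J := by exact_mod_cast hJ
    rw [abs_le] at h3 h4
    linarith [h3.2, h4.1]
  rw [Finset.mem_range] at hi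
  obtain ⟨h2, h3, _⟩ := hscale i hi.le
  have hmain := abs_tsum_mul_le_one hbfin hQ hL1 hb hfin hL h2
    ((hscale (i + 1) hi).2.2.trans h1) (by
      rw [pow_succ Λ, ← mul_assoc r₀]; exact mul_le_mul_of_nonneg_left hΛ h2.le)
    fun l => (hmono i hi l).trans hsmall
  rw [hF0]
  exact (mul_le_mul_of_nonneg_left h3 (abs_nonneg _)).trans hmain

lemma abs_apply_zero_mul_le_one {b : ℤ → ℤ} (hbfin : b.support.Finite) {Q L : ℕ}
    (hQ : 1 ≤ Q) (hL1 : 1 ≤ L) (hb : ∀ n, |b n| ≤ Q) (hfin : {n | b n ≠ b (n - 1)}.Finite)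
    (hL : {n | b n ≠ b (n - 1)}.ncard ≤ L) {F : ℝ → ℝ} (hFc : Continuous F)
    (hF : ∀ θ, charSum (fun n => (b n : ℂ)) θ = F θ) {r₀ : ℝ} (hr₀ : 0 < r₀)
    {Λ : ℝ} (hΛ : 2000 * L ^ 2 * Q ^ 2 ≤ Λ) {J : ℕ} (hJ : 48 * Q ≤ J) (h1 : 2 * r₀ * Λ ^ J ≤ 1)
    (hsign : (∀ θ ∈ Set.Icc r₀ (2 * r₀ * Λ ^ J), 0 ≤ F θ) ∨
      ∀ θ ∈ Set.Icc r₀ (2 * r₀ * Λ ^ J), F θ ≤ 0) :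
    |F 0| * r₀ ≤ 1 := by
  rcases hsign with h | h
  · exact abs_apply_zero_mul_le_one_of_nonneg hbfin hQ hL1 hb hfin hL hFc hF hr₀ hΛ hJ h1 h
  · rw [← abs_neg]
    refine abs_apply_zero_mul_le_one_of_nonneg (b := fun n => -b n) (F := fun θ => -F θ)
      (by simpa using hbfin) hQ hL1 (by simpa using hb) (by simpa using hfin) (by simpa using hL)
      hFc.neg (fun θ => ?_) hr₀ hΛ hJ h1 fun θ hθ => neg_nonneg.2 (h θ hθ)
    rw [Complex.ofReal_neg, ← hF]
    simp [charSum, tsum_neg]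

/-- A function with at most `Z` zeros has constant sign on one of `Z + 1` adjacent intervals. -/
lemma exists_constant_sign {f : ℝ → ℝ} (hf : Continuous f) {S : Set ℝ} (hS : S.Finite)
    (hzero : ∀ θ ∈ Set.Ioo 0 1, f θ = 0 → θ ∈ S) {Z : ℕ} (hZ : S.ncard ≤ Z) {ρ : ℝ} (hρ : 1 < ρ) :
    ∃ i ≤ Z, (∀ θ ∈ Set.Icc (ρ ^ (i + 1))⁻¹ (ρ ^ i)⁻¹, 0 ≤ f θ) ∨
      ∀ θ ∈ Set.Icc (ρ ^ (i + 1))⁻¹ (ρ ^ i)⁻¹, f θ ≤ 0 := by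
  by_contra! hcon
  have hz : ∀ i ≤ Z, ∃ z ∈ S, (ρ ^ (i + 1))⁻¹ < z ∧ z < (ρ ^ i)⁻¹ := fun i hi => by
    obtain ⟨⟨x, hx, hfx⟩, y, hy, hfy⟩ := hcon i hi
    have hmem : (0 : ℝ) ∈ Set.uIcc (f x) (f y) := by
      rw [Set.uIcc_of_le (by linarith)]; exact ⟨hfx.le, hfy.le⟩
    obtain ⟨z, hz, hfz⟩ := intermediate_value_uIcc hf.continuousOn hmem
    have hzx : z ≠ x := by rintro rfl; linarith
    have hzy : z ≠ y := by rintro rfl; linarith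
    have hbd : (ρ ^ (i + 1))⁻¹ < z ∧ z < (ρ ^ i)⁻¹ := by
      rw [Set.mem_uIcc] at hz
      rcases hz with ⟨h1, h2⟩ | ⟨h1, h2⟩
      · exact ⟨hx.1.trans_lt (lt_of_le_of_ne h1 hzx.symm), (lt_of_le_of_ne h2 hzy).trans_le hy.2⟩
      · exact ⟨hy.1.trans_lt (lt_of_le_of_ne h1 hzy.symm), (lt_of_le_of_ne h2 hzx).trans_le hx.2⟩
    refine ⟨z, hzero z ⟨lt_trans (by positivity) hbd.1, hbd.2.trans_le ?_⟩ hfz, hbd⟩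
    exact inv_le_one_of_one_le₀ (one_le_pow₀ hρ.le)
  choose! z hzS hz1 hz2 using hz
  have hlt : ∀ i j, i < j → j ≤ Z → z j < z i := fun i j hij hj =>
    (hz2 j hj).trans_le (le_trans (by gcongr; exacts [hρ.le, hij]) (hz1 i (by lia)).le)
  have hinj : Set.InjOn z (Finset.range (Z + 1)) := fun i hi j hj hij => by
    simp only [Finset.coe_range, Set.mem_Iio] at hi hj
    rcases lt_trichotomy i j with h | h | h
    · exact absurd hij (hlt i j h (by lia)).ne'
    · exact h
    · exact absurd hij (hlt j i h (by lia)).ne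
  have hcard := Set.ncard_le_ncard (s := z '' Finset.range (Z + 1)) (t := S) (by
    rintro _ ⟨i, hi, rfl⟩
    exact hzS i (by simpa [Nat.lt_succ_iff] using hi)) hS
  rw [hinj.ncard_image, Set.ncard_coe_finset, Finset.card_range] at hcard
  lia

/-- A cosine polynomial with few zeros is not large at `0`. -/
lemma abs_apply_zero_le (N : ℕ) (A : ℕ → ℤ) (M : ℕ) (hM : 1 ≤ M) (hA : ∀ n ≤ N, |A n| ≤ M)
    (f : ℝ → ℝ) (hf : ∀ θ, f θ = ∑ n ∈ Finset.range (N + 1), (A n : ℝ) * Real.cos (n * θ))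
    (hf0 : f 0 ≠ 0) {Z T₀ W D K L Q : ℕ}
    (hZ : {θ : ℝ | θ ∈ Set.Icc 0 (2 * Real.pi) ∧ f θ = 0}.ncard ≤ Z)
    (hT₀ : (8 * M + 1) ^ (2 * Z) ≤ T₀) (hW : W = T₀.factorial) (hD : D = 4 * M * W + T₀)
    (hK : 36 * (4 * M * 4 ^ Z) ^ 2 * (2 * (D + 2 * Z) + 1) ^ 4 < K)
    (hL : L = W * ((D + 1) * 64 ^ K)) (hQ : Q = W ^ 2 * (2 * M)) :
    |f 0| ≤ (2 * (2000 * L ^ 2 * Q ^ 2) ^ (48 * Q)) ^ (Z + 1) := by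
  obtain ⟨q, hq⟩ := exists_eval_cos_eq N A
  have hqf : ∀ θ, q.eval (Real.cos θ) = f θ := fun θ => by rw [hq, hf]
  have hq0 : q ≠ 0 := by
    rintro rfl
    exact hf0 (by simpa using (hqf 0).symm)
  have hzfin := finite_zeros_comp_cos q hq0
  simp only [hqf] at hzfin
  have hfc : Continuous f := by rw [funext hf]; fun_prop
  have hW1 : 1 ≤ W := hW ▸ T₀.factorial_pos
  obtain ⟨hYfin, hY⟩ := ncard_symmCoeff_ne_shift_le N A M hA q hq0 hq (by simpa only [hqf] using hZ)
    hT₀ (hW ▸ hD) hK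
  rw [← hW] at hYfin hY
  obtain ⟨b, hbfin, hbQ, hjfin, hjL, hbF⟩ := exists_smoothing (symmCoeff N A)
    (finite_support_symmCoeff N A) W (2 * M) _ (fun n => by
      have := abs_symmCoeff_le N A M hA n
      exact_mod_cast this) hYfin hY
  rw [← hL] at hjL
  set F : ℝ → ℝ := fun θ => ‖∑ i ∈ Finset.range W, character i θ‖ ^ 2 * (2 * f θ) with hF
  have hFc : Continuous F := by fun_prop
  have hbF' : ∀ θ, charSum (fun n => (b n : ℂ)) θ = F θ := fun θ => by
    rw [hbF, charSum_symmCoeff, ← hf, hF]; push_cast; rfl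
  have hQ1 : 1 ≤ Q := by rw [hQ]; exact Nat.mul_pos (by positivity) (by lia)
  have hL1 : 1 ≤ L := by rw [hL]; exact Nat.mul_pos hW1 (by positivity)
  set Λ : ℝ := 2000 * L ^ 2 * Q ^ 2 with hΛ
  have hΛ1 : 1 ≤ Λ := by
    have h1 : (1 : ℝ) ≤ L ^ 2 := one_le_pow₀ (by exact_mod_cast hL1)
    have h2 : (1 : ℝ) ≤ Q ^ 2 := one_le_pow₀ (by exact_mod_cast hQ1)
    rw [hΛ]; nlinarith
  set ρ : ℝ := 2 * Λ ^ (48 * Q) with hρ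
  have hρ1 : 1 < ρ := by
    have := one_le_pow₀ hΛ1 (n := 48 * Q)
    linarith
  obtain ⟨i, hi, hsign⟩ := exists_constant_sign hfc hzfin (fun θ hθ h0 =>
    ⟨⟨hθ.1.le, by linarith [hθ.2, Real.pi_gt_three]⟩, h0⟩) hZ hρ1
  have hend : 2 * (ρ ^ (i + 1))⁻¹ * Λ ^ (48 * Q) = (ρ ^ i)⁻¹ := by
    rw [mul_right_comm, ← hρ, pow_succ]
    field_simp
  have hmain := abs_apply_zero_mul_le_one (r₀ := (ρ ^ (i + 1))⁻¹) hbfin hQ1 hL1 (fun n => by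
    rw [hQ]; exact_mod_cast hbQ n) hjfin hjL hFc hbF' (by positivity) le_rfl le_rfl
    (hend.trans_le (inv_le_one_of_one_le₀ (one_le_pow₀ hρ1.le))) (by
      rw [hend]
      refine hsign.imp (fun h θ hθ => ?_) fun h θ hθ => ?_
      · exact mul_nonneg (by positivity) (mul_nonneg zero_le_two (h θ hθ))
      · exact mul_nonpos_of_nonneg_of_nonpos (by positivity)
          (mul_nonpos_of_nonneg_of_nonpos zero_le_two (h θ hθ)))
  rw [← div_eq_mul_inv, div_le_one (by positivity)] at hmain
  have hF0 : |f 0| ≤ |F 0| := by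
    have h1 : F 0 = W ^ 2 * (2 * f 0) := by simp [hF, character]
    have h2 : (1 : ℝ) ≤ W ^ 2 := one_le_pow₀ (by exact_mod_cast hW1)
    rw [h1, abs_mul, abs_mul, abs_of_nonneg (by positivity : (0 : ℝ) ≤ W ^ 2), abs_two]
    nlinarith [abs_nonneg (f 0)]
  exact hF0.trans (hmain.trans (pow_le_pow_right₀ hρ1.le (by lia)))

/-- The bound of `abs_apply_zero_le` in closed form. -/
lemma scale_bound_le {M Z T W D K L Q : ℕ} (hM : 1 ≤ M) (hT : T = (8 * M + 1) ^ (2 * Z + 2))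
    (hTW : T ≤ W) (hD : D = 4 * M * W + T)
    (hK : K = 36 * (4 * M * 4 ^ Z) ^ 2 * (2 * (D + 2 * Z) + 1) ^ 4 + 1)
    (hL : L = W * ((D + 1) * 64 ^ K)) (hQ : Q = W ^ 2 * (2 * M)) :
    (2 * (2000 * L ^ 2 * Q ^ 2) ^ (48 * Q)) ^ (Z + 1) ≤ W ^ W ^ 24 := by
  have h81 : 81 ^ (Z + 1) ≤ T := by
    rw [hT, show 2 * Z + 2 = 2 * (Z + 1) by ring, pow_mul]
    exact Nat.pow_le_pow_left (Nat.pow_le_pow_left (by lia : 9 ≤ 8 * M + 1) 2) _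
  have hZW : Z + 1 ≤ W := ((Nat.lt_pow_self (by norm_num)).le.trans h81).trans hTW
  have hW81 : 81 ≤ W := ((Nat.le_self_pow (by lia) 81).trans h81).trans hTW
  have h4W : 4 ^ Z ≤ W := by
    refine le_trans ?_ (h81.trans hTW)
    exact (Nat.pow_le_pow_left (by norm_num) Z).trans (Nat.pow_le_pow_right (by norm_num) (by lia))
  have hMW : M ≤ W := by
    refine le_trans ?_ hTW
    rw [hT]
    exact (by lia : M ≤ 8 * M + 1).trans (Nat.le_self_pow (by lia) _)
  have hD5 : D ≤ 5 * W ^ 2 := by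
    have : M * W ≤ W * W := Nat.mul_le_mul_right W hMW
    nlinarith
  have hK16 : K ≤ W ^ 16 := by
    have h1 : 2 * (D + 2 * Z) + 1 ≤ 15 * W ^ 2 := by nlinarith
    calc K ≤ 36 * (4 * W * W) ^ 2 * (15 * W ^ 2) ^ 4 + 1 := by rw [hK]; gcongr
      _ = 29160000 * W ^ 12 + 1 := by ring
      _ ≤ 29160000 * W ^ 12 + 1 * W ^ 12 := by have := Nat.one_le_pow 12 W (by lia); lia
      _ = 29160001 * W ^ 12 := by ring
      _ ≤ 81 ^ 4 * W ^ 12 := by gcongr; norm_num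
      _ ≤ W ^ 4 * W ^ 12 := by gcongr
      _ = W ^ 16 := by ring
  have hQ4 : Q ≤ W ^ 4 := by
    calc Q ≤ W ^ 2 * (W * W) := by rw [hQ]; gcongr; lia
      _ = W ^ 4 := by ring
  have hL4 : L ≤ W ^ 4 * W ^ W ^ 16 := by
    have h1 : D + 1 ≤ W * W ^ 2 := by nlinarith [sq_nonneg W]
    have h64 : 64 ^ K ≤ W ^ W ^ 16 :=
      (Nat.pow_le_pow_left (by lia) K).trans (Nat.pow_le_pow_right (by lia) hK16)
    calc L ≤ W * (W * W ^ 2 * W ^ W ^ 16) := by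
          rw [hL]
          exact Nat.mul_le_mul_left _ (Nat.mul_le_mul h1 h64)
      _ = _ := by ring
  have hΛ : 2000 * L ^ 2 * Q ^ 2 ≤ W ^ W ^ 17 := by
    calc _ ≤ W ^ 2 * (W ^ 4 * W ^ W ^ 16) ^ 2 * (W ^ 4) ^ 2 := by gcongr; nlinarith
      _ = W ^ (18 + 2 * W ^ 16) := by ring
      _ ≤ W ^ W ^ 17 := by
        refine Nat.pow_le_pow_right (by lia) ?_
        have := Nat.le_self_pow (n := 16) (by lia) W
        rw [pow_succ W 16]; nlinarith
  calc _ ≤ (W * (W ^ W ^ 17) ^ (W * W ^ 4)) ^ W := by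
        have h2W : 2 ≤ W := by lia
        have h48 : 48 * Q ≤ W * W ^ 4 := Nat.mul_le_mul (by lia) hQ4
        have hone : 1 ≤ W ^ W ^ 17 := Nat.one_le_pow _ _ (by lia)
        refine (Nat.pow_le_pow_left (Nat.mul_le_mul h2W ((Nat.pow_le_pow_left hΛ _).trans
          (Nat.pow_le_pow_right hone h48))) _).trans (Nat.pow_le_pow_right ?_ hZW)
        exact Nat.mul_pos (by lia) (Nat.pow_pos (by lia))
    _ = W ^ ((1 + W ^ 22) * W) := by
        rw [← pow_mul, ← pow_succ', ← pow_mul]; ring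
    _ ≤ W ^ W ^ 24 := by
        refine Nat.pow_le_pow_right (by lia) ?_
        have := Nat.one_le_pow 22 W (by lia)
        calc (1 + W ^ 22) * W ≤ (W * W ^ 22) * W := by gcongr; nlinarith
          _ = W ^ 24 := by ring

lemma log_log_log_le_of_le_pow {M Z : ℕ} (hM : 1 ≤ M) {x : ℝ} (hx0 : 0 < x)
    (hx : Real.exp (Real.exp 1) < Real.log x) {T : ℕ}
    (hT : T = (8 * M + 1) ^ (2 * Z + 2)) (h : x ≤ (T.factorial : ℝ) ^ T.factorial ^ 24) :
    Real.log (Real.log (Real.log x)) ≤ 18 * (Z + 1) * (1 + Real.log M) := by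
  set W := T.factorial with hW
  have hT81 : 81 ≤ T := by
    rw [hT, pow_add]
    nlinarith [Nat.one_le_pow (2 * Z) (8 * M + 1) (by lia)]
  have hW1 : (1 : ℝ) ≤ W := by exact_mod_cast T.factorial_pos
  have hT' : (81 : ℝ) ≤ T := by exact_mod_cast hT81
  have hx1 : 0 < Real.log x := (Real.exp_pos _).trans hx
  have hll : Real.exp 1 < Real.log (Real.log x) := (Real.lt_log_iff_exp_lt hx1).2 hx
  have h1 : Real.log x ≤ (W : ℝ) ^ 25 := by
    calc _ ≤ Real.log ((W : ℝ) ^ W ^ 24) := Real.log_le_log hx0 h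
      _ = W ^ 24 * Real.log W := by rw [Real.log_pow]; push_cast; rfl
      _ ≤ W ^ 24 * W := by gcongr; exact Real.log_le_self (by linarith)
      _ = _ := by ring
  have hlogW : Real.log W ≤ (T : ℝ) ^ 2 := by
    calc Real.log W ≤ Real.log ((T : ℝ) ^ T) := Real.log_le_log (by linarith)
          (by exact_mod_cast T.factorial_le_pow)
      _ = T * Real.log T := Real.log_pow _ _
      _ ≤ T * T := by gcongr; exact Real.log_le_self (by linarith)
      _ = _ := by ring
  have h2 : Real.log (Real.log x) ≤ (T : ℝ) ^ 3 := by
    calc _ ≤ Real.log ((W : ℝ) ^ 25) := Real.log_le_log hx1 h1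
      _ = 25 * Real.log W := by rw [Real.log_pow]; norm_num
      _ ≤ T * T ^ 2 := by gcongr; linarith
      _ = _ := by ring
  have hM' : (1 : ℝ) ≤ M := by exact_mod_cast hM
  have hlogT : Real.log T ≤ (2 * Z + 2) * (3 * (1 + Real.log M)) := by
    have h9 : Real.log 9 ≤ 3 := by
      rw [Real.log_le_iff_le_exp (by norm_num)]
      have := Real.exp_one_gt_d9
      calc (9 : ℝ) ≤ 2.7 ^ 3 := by norm_num
        _ ≤ Real.exp 1 ^ 3 := by gcongr; linarith
        _ = Real.exp 3 := by rw [← Real.exp_nat_mul]; norm_num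
    rw [hT]
    push_cast
    rw [Real.log_pow]
    push_cast
    gcongr
    calc Real.log (8 * M + 1) ≤ Real.log (9 * M) := Real.log_le_log (by positivity) (by linarith)
      _ = Real.log 9 + Real.log M := Real.log_mul (by norm_num) (by positivity)
      _ ≤ _ := by nlinarith [Real.log_nonneg hM']
  calc _ ≤ Real.log ((T : ℝ) ^ 3) := Real.log_le_log ((Real.exp_pos _).trans hll) h2
    _ = 3 * Real.log T := by rw [Real.log_pow]; norm_num
    _ ≤ 3 * ((2 * Z + 2) * (3 * (1 + Real.log M))) := by gcongr
    _ = _ := by ring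

/-- Erdélyi. There is an absolute constant `c > 0` such that for every
finite `R ⊂ ℤ`, every cosine polynomial `f(θ) = Σ_{n=0}^N A_n cos(nθ)` with coefficients
in `R` and `|f 0| > e^{e^e}` has at least
`(c/(1 + log M(R))) · (logloglog |f 0|)/(loglogloglog |f 0|) − 1`
distinct zeros in `[0, 2π]`, where `M(R) = max_{r ∈ R} |r|`. -/
theorem stmt2 :
    ∃ c : ℝ, 0 < c ∧
      ∀ (R : Finset ℤ) (N : ℕ) (A : ℕ → ℤ) (f : ℝ → ℝ),
        (∀ n ≤ N, A n ∈ R) →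
        (∀ θ : ℝ, f θ = ∑ n ∈ Finset.range (N + 1), (A n : ℝ) * Real.cos (n * θ)) →
        Real.exp (Real.exp (Real.exp 1)) < |f 0| →
        (c / (1 + Real.log ((R.sup fun r => r.natAbs : ℕ) : ℝ))) *
            (Real.log (Real.log (Real.log |f 0|)) /
              Real.log (Real.log (Real.log (Real.log |f 0|)))) - 1 ≤
          (Set.ncard {θ : ℝ | θ ∈ Set.Icc 0 (2 * Real.pi) ∧ f θ = 0} : ℝ) := by
  have hlog : ∀ x : ℝ, Real.exp (Real.exp (Real.exp 1)) < x →
      0 < x ∧ Real.exp (Real.exp 1) < Real.log x ∧ Real.exp 1 < Real.log (Real.log x) ∧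
        1 < Real.log (Real.log (Real.log x)) := fun x hx => by
    have h0 : 0 < x := (Real.exp_pos _).trans hx
    have h1 := (Real.lt_log_iff_exp_lt h0).2 hx
    have h2 := (Real.lt_log_iff_exp_lt ((Real.exp_pos _).trans h1)).2 h1
    exact ⟨h0, h1, h2, (Real.lt_log_iff_exp_lt ((Real.exp_pos _).trans h2)).2 h2⟩
  set n₀ : ℕ := ⌊Real.exp (Real.exp (Real.exp 1))⌋₊ + 1 with hn₀
  obtain ⟨hn1, hn2, hn3, hn4⟩ := hlog n₀ (by rw [hn₀]; push_cast; exact Nat.lt_floor_add_one _)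
  set c₀ := Real.log (Real.log (Real.log (Real.log n₀))) with hc₀
  have hc₀pos : 0 < c₀ := Real.log_pos hn4
  refine ⟨c₀ / 18, by positivity, fun R N A f hA hf hf0 => ?_⟩
  set M : ℕ := R.sup fun r => r.natAbs with hMdef
  set Z := Set.ncard {θ : ℝ | θ ∈ Set.Icc 0 (2 * Real.pi) ∧ f θ = 0} with hZ
  obtain ⟨hx1, hx2, hx3, hx4⟩ := hlog _ hf0
  have hf0ne : f 0 ≠ 0 := abs_pos.1 hx1
  have hAM : ∀ n ≤ N, |A n| ≤ M := fun n hn => by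
    have := Finset.le_sup (f := fun r : ℤ => r.natAbs) (hA n hn)
    rw [Int.abs_eq_natAbs]; exact_mod_cast this
  have hM : 1 ≤ M := by
    by_contra! hM0
    refine hf0ne ?_
    rw [hf]
    refine Finset.sum_eq_zero fun n hn => ?_
    have := hAM n (by simpa [Nat.lt_succ_iff] using hn)
    have hz : A n = 0 := abs_eq_zero.1 (le_antisymm (by lia) (abs_nonneg _))
    simp [hz]
  have hgap : (n₀ : ℝ) ≤ |f 0| := by
    have h1 : |f 0| = ((∑ n ∈ Finset.range (N + 1), A n).natAbs : ℝ) := by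
      rw [Nat.cast_natAbs, Int.cast_abs, hf]; simp
    rw [h1] at hf0 ⊢
    exact_mod_cast Nat.succ_le_of_lt ((Nat.floor_lt (Real.exp_pos _).le).2 hf0)
  have hc₀le : c₀ ≤ Real.log (Real.log (Real.log (Real.log |f 0|))) := by
    have e1 := Real.exp_pos 1
    have e2 := Real.exp_pos (Real.exp 1)
    exact Real.log_le_log (by linarith) (Real.log_le_log (by linarith)
      (Real.log_le_log (by linarith) (Real.log_le_log hn1 hgap)))
  set T := (8 * M + 1) ^ (2 * Z + 2) with hT
  have hbound := abs_apply_zero_le N A M hM hAM f hf hf0ne (Z := Z) (T₀ := T) hZ.symm.ge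
    (Nat.pow_le_pow_right (by lia) (by lia)) rfl rfl (Nat.lt_succ_self _) rfl rfl
  have hscale := scale_bound_le hM hT T.self_le_factorial rfl rfl rfl rfl
  have hx := log_log_log_le_of_le_pow hM hx1 hx2 hT (hbound.trans (by exact_mod_cast hscale))
  set X := Real.log (Real.log (Real.log |f 0|)) with hX
  have hM' : 0 < 1 + Real.log M := by
    have := Real.log_nonneg (by exact_mod_cast hM : (1 : ℝ) ≤ M)
    linarith
  calc _ ≤ c₀ / 18 / (1 + Real.log M) * (18 * (Z + 1) * (1 + Real.log M) / c₀) - 1 := by gcongr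
    _ = Z := by field_simp; ring
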